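/- arXiv:0706.3523 — 2 statements merged into one kernel-verified Lean document; each statement's English description precedes it below -/
import Mathlib

section
/- For every non-null countable ordinal ξ there exists a set A of finite binary words (A ⊆ 2^{<ω}) such that the ω-power A^ω is a Σ^0_ξ-complete subset of the Cantor space 2^ω; that is, A^ω belongs to Σ^0_ξ(2^ω) and for every finite alphabet Y and every set E ⊆ Y^ω with E ∈ Σ^0_ξ(Y^ω) there is a continuous map f : Y^ω → 2^ω with E = f^{-1}(A^ω). -/
open Set

/-- The ω-power of a finitary language `V ⊆ α^{<ω}`: the set of infinite words that can be
cut into consecutive finite blocks, each belonging to `V`. -/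
def omegaPower {α : Type*} (V : Set (List α)) : Set (ℕ → α) :=
  { x | ∃ f : ℕ → ℕ, f 0 = 0 ∧ StrictMono f ∧
      ∀ k, (List.ofFn fun i : Fin (f (k + 1) - f k) => x (f k + i.val)) ∈ V }

/-- The classes `Σ⁰_ξ` of the Borel hierarchy on a topological space `X`:
`Σ⁰_1` is the class of open sets, and for `ξ > 1`, `Σ⁰_ξ` is the class of countable unions
of sets whose complements lie in `⋃_{γ < ξ} Σ⁰_γ`. -/
inductive SigmaO {X : Type*} [TopologicalSpace X] : Ordinal.{0} → Set X → Prop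
  | isOpen (s : Set X) : IsOpen s → SigmaO 1 s
  | iUnion (ξ : Ordinal.{0}) (hξ : 1 < ξ) (f : ℕ → Set X) (g : ℕ → Ordinal.{0})
      (hg : ∀ n, g n < ξ) (hf : ∀ n, SigmaO (g n) (f n)ᶜ) : SigmaO ξ (⋃ n, f n)

set_option linter.unusedSectionVars false

/-! ### Words, prefixes and tails -/

/-- The prefix of length `n` of an infinite word. -/
def pre {α : Type*} (x : ℕ → α) (n : ℕ) : List α := List.ofFn fun i : Fin n => x i.val

/-- The tail of an infinite word. -/
def tl {α : Type*} (a : ℕ) (x : ℕ → α) : ℕ → α := fun i => x (a + i)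

theorem pre_inj {α : Type*} {x y : ℕ → α} {n m : ℕ} :
    pre x n = pre y m ↔ n = m ∧ ∀ i < n, x i = y i := by
  constructor
  · intro h
    have hl : n = m := by
      have := congrArg List.length h
      simpa [pre] using this
    subst hl
    refine ⟨rfl, fun i hi => ?_⟩
    have := List.ofFn_injective h
    exact congrFun this ⟨i, hi⟩
  · rintro ⟨rfl, h⟩
    unfold pre
    congr 1
    funext i
    exact h i i.2

theorem tl_tl {α : Type*} (a b : ℕ) (x : ℕ → α) : tl b (tl a x) = tl (a + b) x := by
  funext i; simp [tl, add_assoc]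

/-- The language given by a predicate on prefixes of infinite words. -/
def lang {α : Type*} (Q : (ℕ → α) → ℕ → Prop) : Set (List α) :=
  {u | ∃ x n, u = pre x n ∧ Q x n}

theorem pre_mem_lang {α : Type*} {Q : (ℕ → α) → ℕ → Prop} {x : ℕ → α} {n : ℕ} :
    pre x n ∈ lang Q ↔ ∃ z, (∀ i < n, x i = z i) ∧ Q z n := by
  constructor
  · rintro ⟨z, m, h, hQ⟩
    obtain ⟨rfl, h'⟩ := pre_inj.1 h
    exact ⟨z, h', hQ⟩
  · rintro ⟨z, h, hQ⟩
    exact ⟨z, n, pre_inj.2 ⟨rfl, h⟩, hQ⟩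

/-- One block of the decomposition. -/
def Blk {α : Type*} (V : Set (List α)) (x : ℕ → α) (a b : ℕ) : Prop :=
  a < b ∧ pre (tl a x) (b - a) ∈ V

/-- Infinite decomposition from position `a` on. -/
def Dec {α : Type*} (V : Set (List α)) (x : ℕ → α) (a : ℕ) : Prop :=
  ∃ f : ℕ → ℕ, f 0 = a ∧ ∀ k, Blk V x (f k) (f (k + 1))

theorem mem_omegaPower {α : Type*} {V : Set (List α)} {x : ℕ → α} :
    x ∈ omegaPower V ↔ Dec V x 0 := by
  constructor
  · rintro ⟨f, h0, hm, h⟩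
    exact ⟨f, h0, fun k => ⟨hm (Nat.lt_succ_self k), h k⟩⟩
  · rintro ⟨f, h0, h⟩
    exact ⟨f, h0, strictMono_nat_of_lt_succ fun k => (h k).1, fun k => (h k).2⟩

theorem Blk_tl {α : Type*} {V : Set (List α)} {x : ℕ → α} {a b c : ℕ} :
    Blk V (tl a x) b c ↔ Blk V x (a + b) (a + c) := by
  unfold Blk
  rw [tl_tl, Nat.add_sub_add_left]
  simp

theorem Dec_tl {α : Type*} {V : Set (List α)} {x : ℕ → α} {a b : ℕ} :
    Dec V (tl a x) b ↔ Dec V x (a + b) := by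
  constructor
  · rintro ⟨f, h0, h⟩
    exact ⟨fun k => a + f k, by simp [h0], fun k => Blk_tl.1 (h k)⟩
  · rintro ⟨f, h0, h⟩
    have hge : ∀ k, a ≤ f k := by
      intro k
      induction k with
      | zero => omega
      | succ k ih => have := (h k).1; omega
    refine ⟨fun k => f k - a, by simp [h0], fun k => ?_⟩
    rw [Blk_tl]
    have h1 := hge k
    have h2 := hge (k + 1)
    rw [Nat.add_sub_cancel' h1, Nat.add_sub_cancel' h2]
    exact h k

theorem tl_mem {α : Type*} {V : Set (List α)} {x : ℕ → α} {a : ℕ} :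
    tl a x ∈ omegaPower V ↔ Dec V x a := by
  rw [mem_omegaPower, Dec_tl, add_zero]

theorem Dec.cons {α : Type*} {V : Set (List α)} {x : ℕ → α} {a b : ℕ}
    (h : Blk V x a b) (hd : Dec V x b) : Dec V x a := by
  obtain ⟨f, h0, hf⟩ := hd
  refine ⟨fun n => Nat.casesOn n a f, rfl, fun k => ?_⟩
  cases k with
  | zero => simpa [h0] using h
  | succ k => exact hf k

/-- Positions reachable by finitely many blocks. -/
def Reach {α : Type*} (V : Set (List α)) (x : ℕ → α) (p : ℕ) : Prop :=
  Relation.ReflTransGen (Blk V x) 0 p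

theorem Reach.dec {α : Type*} {V : Set (List α)} {x : ℕ → α} {p : ℕ}
    (h : Reach V x p) (hd : Dec V x p) : Dec V x 0 := by
  unfold Reach at h
  generalize (0 : ℕ) = o at h ⊢
  induction h using Relation.ReflTransGen.head_induction_on with
  | refl => exact hd
  | head hab _ ih => exact Dec.cons hab ih

theorem Dec.reach {α : Type*} {V : Set (List α)} {x : ℕ → α}
    (hd : Dec V x 0) (N : ℕ) : ∃ p, N ≤ p ∧ Reach V x p ∧ Dec V x p := by
  obtain ⟨f, h0, hf⟩ := hd
  refine ⟨f N, (strictMono_nat_of_lt_succ fun k => (hf k).1).id_le N, ?_,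
    fun k => f (N + k), rfl, fun k => hf (N + k)⟩
  unfold Reach
  generalize N = N
  induction N with
  | zero => rw [h0]
  | succ k ih => exact ih.tail (hf k)

theorem Reach.congr {α : Type*} {V : Set (List α)} {x z : ℕ → α} {p : ℕ}
    (h : Reach V x p) (hz : ∀ i < p, z i = x i) : Reach V z p := by
  unfold Reach at *
  induction h with
  | refl => exact .refl
  | @tail b c hab hbc ih =>
    refine (ih fun i hi => hz i (hi.trans hbc.1)).tail ⟨hbc.1, ?_⟩
    have : pre (tl b z) (c - b) = pre (tl b x) (c - b) :=
      pre_inj.2 ⟨rfl, fun i hi => hz _ (by omega)⟩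
    rw [this]
    exact hbc.2

/-- The Koenig lemma for decompositions. -/
theorem konig {α : Type*} {V : Set (List α)} {x : ℕ → α}
    (hfin : ∀ a, {b | Blk V x a b}.Finite) (hinf : ∀ N, ∃ p, N ≤ p ∧ Reach V x p) :
    Dec V x 0 := by
  let G : ℕ → Prop := fun a => {p | Relation.ReflTransGen (Blk V x) a p}.Infinite
  have h0 : G 0 := by
    refine Set.infinite_of_not_bddAbove ?_
    rintro ⟨M, hM⟩
    obtain ⟨p, hp, hr⟩ := hinf (M + 1)
    have := hM hr
    omega
  have hstep : ∀ a, G a → ∃ b, Blk V x a b ∧ G b := by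
    intro a ha
    by_contra hcon
    push Not at hcon
    apply ha
    have hsub : {p | Relation.ReflTransGen (Blk V x) a p} ⊆
        {a} ∪ ⋃ b ∈ {b | Blk V x a b}, {p | Relation.ReflTransGen (Blk V x) b p} := by
      intro p hp
      rcases Relation.ReflTransGen.cases_head hp with h | ⟨b, hb, hbp⟩
      · left; exact h.symm
      · right
        simp only [mem_iUnion]
        exact ⟨b, hb, hbp⟩
    refine Set.Finite.subset ?_ hsub
    refine (Set.finite_singleton a).union ((hfin a).biUnion fun b hb => ?_)
    exact Set.not_infinite.1 (hcon b hb)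
  choose! nx hn1 hn2 using hstep
  have hG : ∀ k, G (nx^[k] 0) := by
    intro k
    induction k with
    | zero => exact h0
    | succ k ih => rw [Function.iterate_succ_apply']; exact hn2 _ ih
  refine ⟨fun k => nx^[k] 0, rfl, fun k => ?_⟩
  simp only [Function.iterate_succ_apply']
  exact hn1 _ (hG k)

/-! ### Topology of sequence spaces -/

section Top
variable {Y : Type*} [TopologicalSpace Y] [DiscreteTopology Y]

theorem isOpen_of_dep {S : Set (ℕ → Y)} (N : ℕ)
    (h : ∀ x z : ℕ → Y, (∀ i < N, x i = z i) → x ∈ S → z ∈ S) : IsOpen S := by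
  rw [isOpen_iff_mem_nhds]
  intro x hx
  have ho : IsOpen (⋂ i ∈ Finset.range N, {z : ℕ → Y | z i = x i}) := by
    apply isOpen_biInter_finset
    intro i _
    exact (isOpen_discrete ({x i} : Set Y)).preimage
      (continuous_apply (A := fun _ : ℕ => Y) i)
  refine Filter.mem_of_superset (ho.mem_nhds (by simp)) ?_
  intro z hz
  refine h x z (fun i hi => ?_) hx
  simp only [mem_iInter] at hz
  exact (hz i (Finset.mem_range.2 hi)).symm

theorem isClopen_of_dep {S : Set (ℕ → Y)} (N : ℕ)
    (h : ∀ x z : ℕ → Y, (∀ i < N, x i = z i) → x ∈ S → z ∈ S) : IsClopen S :=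
  ⟨⟨isOpen_of_dep N fun x z hxz hx hz => hx (h z x (fun i hi => (hxz i hi).symm) hz)⟩,
    isOpen_of_dep N h⟩

theorem continuous_of_dep {D : Type*} [TopologicalSpace D] {f : (ℕ → Y) → D}
    (h : ∃ N : ℕ, ∀ x z : ℕ → Y, (∀ i < N, x i = z i) → f x = f z) : Continuous f := by
  obtain ⟨N, h⟩ := h
  refine continuous_def.2 fun s _ => isOpen_of_dep N fun x z hxz hx => ?_
  rw [mem_preimage, ← h x z hxz]
  exact hx

theorem exists_dep {O : Set (ℕ → Y)} (hO : IsOpen O) {x : ℕ → Y} (hx : x ∈ O) :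
    ∃ n : ℕ, ∀ z : ℕ → Y, (∀ i < n, x i = z i) → z ∈ O := by
  obtain ⟨I, u, hu, hsub⟩ := isOpen_pi_iff.1 hO x hx
  refine ⟨I.sup id + 1, fun z hz => hsub ?_⟩
  intro i hi
  have : i ≤ I.sup id := Finset.le_sup (f := id) hi
  rw [← hz i (by omega)]
  exact (hu i hi).2

theorem mem_closure_of_dep {S : Set (ℕ → Y)} {x : ℕ → Y}
    (h : ∀ n : ℕ, ∃ z ∈ S, ∀ i < n, x i = z i) : x ∈ closure S := by
  rw [mem_closure_iff]
  intro O hO hx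
  obtain ⟨n, hn⟩ := exists_dep hO hx
  obtain ⟨z, hz, hxz⟩ := h n
  exact ⟨z, hn z hxz, hz⟩

/-- The interior approximations of a set. -/
def appr (O : Set (ℕ → Y)) (n : ℕ) : Set (ℕ → Y) :=
  {x | ∀ z : ℕ → Y, (∀ i < n, x i = z i) → z ∈ O}

theorem appr_mono {O : Set (ℕ → Y)} {n m : ℕ} (h : n ≤ m) : appr O n ⊆ appr O m :=
  fun _ hx z hz => hx z fun i hi => hz i (hi.trans_le h)

theorem appr_dep {O : Set (ℕ → Y)} {n : ℕ} (x z : ℕ → Y) (h : ∀ i < n, x i = z i)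
    (hx : x ∈ appr O n) : z ∈ appr O n :=
  fun w hw => hx w fun i hi => (h i hi).trans (hw i hi)

theorem iUnion_appr {O : Set (ℕ → Y)} (hO : IsOpen O) : ⋃ n, appr O n = O := by
  ext x
  simp only [mem_iUnion]
  exact ⟨fun ⟨n, h⟩ => h x fun _ _ => rfl, fun hx => exists_dep hO hx⟩

theorem isClopen_appr (O : Set (ℕ → Y)) (n : ℕ) : IsClopen (appr O n) :=
  isClopen_of_dep n fun x z h hx => appr_dep x z h hx

end Top

/-! ### The Borel classes -/

section Sig
variable {X : Type*} [TopologicalSpace X]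

theorem SigmaO.pos {ξ : Ordinal.{0}} {s : Set X} (h : SigmaO ξ s) : 1 ≤ ξ := by
  cases h with
  | isOpen _ _ => exact le_rfl
  | iUnion _ h _ _ _ _ => exact h.le

theorem SigmaO.one {s : Set X} (h : SigmaO 1 s) : IsOpen s := by
  generalize hη : (1 : Ordinal.{0}) = η at h
  cases h with
  | isOpen _ h => exact h
  | iUnion _ h _ _ _ _ => exact absurd hη h.ne

theorem SigmaO.exists_iUnion {ξ : Ordinal.{0}} {s : Set X} (h : SigmaO ξ s) (hξ : 1 < ξ) :
    ∃ (f : ℕ → Set X) (g : ℕ → Ordinal.{0}), (∀ n, g n < ξ) ∧ (∀ n, SigmaO (g n) (f n)ᶜ) ∧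
      s = ⋃ n, f n := by
  cases h with
  | isOpen _ _ => exact absurd hξ (lt_irrefl _)
  | iUnion _ _ f g hg hf => exact ⟨f, g, hg, hf, rfl⟩

theorem SigmaO.preimage {Z : Type*} [TopologicalSpace Z] {e : Z → X} (he : Continuous e)
    {ξ : Ordinal.{0}} {s : Set X} (h : SigmaO ξ s) : SigmaO ξ (e ⁻¹' s) := by
  induction h with
  | isOpen s hs => exact .isOpen _ (hs.preimage he)
  | iUnion ξ hξ f g hg _ ih =>
    rw [preimage_iUnion]
    exact .iUnion ξ hξ _ g hg ih

theorem SigmaO.exists_preimage {Z : Type*} [TopologicalSpace Z] {e : Z → X}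
    (he : Topology.IsInducing e) {ξ : Ordinal.{0}} {s : Set Z} (h : SigmaO ξ s) :
    ∃ t : Set X, SigmaO ξ t ∧ e ⁻¹' t = s := by
  induction h with
  | isOpen s hs =>
    obtain ⟨t, ht, h⟩ := he.isOpen_iff.1 hs
    exact ⟨t, .isOpen _ ht, h⟩
  | iUnion ξ hξ f g hg _ ih =>
    choose t ht h using ih
    refine ⟨⋃ n, (t n)ᶜ, .iUnion ξ hξ _ g hg fun n => by simpa using ht n, ?_⟩
    simp [h]

theorem SigmaO.of_compl {η ξ : Ordinal.{0}} {s : Set X} (h : SigmaO η sᶜ) (hη : η < ξ) :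
    SigmaO ξ s := by
  have := SigmaO.iUnion ξ (h.pos.trans_lt hη) (fun _ => s) (fun _ => η) (fun _ => hη)
    (fun _ => h)
  rwa [iUnion_const] at this

theorem SigmaO.of_isClosed {ξ : Ordinal.{0}} {s : Set X} (h : IsClosed s) (hξ : 1 < ξ) :
    SigmaO ξ s := SigmaO.of_compl (.isOpen _ h.isOpen_compl) hξ

theorem SigmaO.univ {ξ : Ordinal.{0}} (hξ : 1 ≤ ξ) : SigmaO ξ (Set.univ : Set X) := by
  rcases hξ.eq_or_lt with rfl | h
  · exact .isOpen _ isOpen_univ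
  · exact .of_isClosed isClosed_univ h

theorem SigmaO.iUnion' {ξ : Ordinal.{0}} (hξ : 1 < ξ) {s : ℕ → Set X}
    (h : ∀ n, SigmaO ξ (s n)) : SigmaO ξ (⋃ n, s n) := by
  choose f g hg hf hs using fun n => (h n).exists_iUnion hξ
  have := SigmaO.iUnion ξ hξ (fun m => f m.unpair.1 m.unpair.2)
    (fun m => g m.unpair.1 m.unpair.2) (fun m => hg _ _) (fun m => hf _ _)
  convert this using 1
  ext x
  simp only [hs, mem_iUnion]
  constructor
  · rintro ⟨i, j, h⟩
    exact ⟨Nat.pair i j, by simpa using h⟩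
  · rintro ⟨m, h⟩
    exact ⟨_, _, h⟩

theorem SigmaO.iUnion_countable {ι : Type*} [Countable ι] [Nonempty ι] {ξ : Ordinal.{0}}
    (hξ : 1 < ξ) {s : ι → Set X} (h : ∀ n, SigmaO ξ (s n)) : SigmaO ξ (⋃ n, s n) := by
  obtain ⟨g, hg⟩ := exists_surjective_nat ι
  rw [← hg.iUnion_comp]
  exact SigmaO.iUnion' hξ fun n => h _

theorem SigmaO.union {ξ : Ordinal.{0}} (hξ : 1 < ξ) {s t : Set X}
    (hs : SigmaO ξ s) (ht : SigmaO ξ t) : SigmaO ξ (s ∪ t) := by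
  rw [Set.union_eq_iUnion]
  exact SigmaO.iUnion_countable hξ fun b => by cases b <;> assumption

variable {Y : Type*} [TopologicalSpace Y] [DiscreteTopology Y]

theorem SigmaO.of_isOpen {ξ : Ordinal.{0}} {s : Set (ℕ → Y)} (h : IsOpen s) (hξ : 1 ≤ ξ) :
    SigmaO ξ s := by
  rcases hξ.eq_or_lt with rfl | hξ
  · exact .isOpen _ h
  · rw [← iUnion_appr h]
    exact .iUnion' hξ fun n => .of_isClosed (isClopen_appr s n).1 hξ

theorem SigmaO.union_isOpen {ξ : Ordinal.{0}} {s t : Set (ℕ → Y)} (hs : SigmaO ξ s)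
    (ht : IsOpen t) : SigmaO ξ (s ∪ t) := by
  rcases hs.pos.eq_or_lt with rfl | hξ
  · exact .isOpen _ (hs.one.union ht)
  · exact hs.union hξ (.of_isOpen ht hξ.le)

theorem SigmaO.inter_isClosed {ξ : Ordinal.{0}} (hξ : 1 < ξ) {s t : Set (ℕ → Y)}
    (hs : SigmaO ξ s) (ht : IsClosed t) : SigmaO ξ (s ∩ t) := by
  obtain ⟨f, g, hg, hf, rfl⟩ := hs.exists_iUnion hξ
  rw [iUnion_inter]
  refine .iUnion ξ hξ _ g hg fun n => ?_
  rw [compl_inter]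
  exact (hf n).union_isOpen ht.isOpen_compl

end Sig

/-! ### Transition systems with open labels -/

/-- The set of points admitting an infinite run from state `q`. -/
def PP {X Q : Type*} (U : Q → Q → Set X) (q : Q) : Set X :=
  {y | ∃ σ : ℕ → Q, σ 0 = q ∧ ∀ i, y ∈ U (σ i) (σ (i + 1))}

theorem PP_step {X Q : Type*} {U : Q → Q → Set X} {q : Q} {y : X} :
    y ∈ PP U q ↔ ∃ r, y ∈ U q r ∧ y ∈ PP U r := by
  constructor
  · rintro ⟨σ, rfl, h⟩
    exact ⟨σ 1, h 0, fun i => σ (i + 1), rfl, fun i => h (i + 1)⟩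
  · rintro ⟨r, hr, σ, rfl, h⟩
    refine ⟨fun n => Nat.casesOn n q σ, rfl, fun k => ?_⟩
    cases k with
    | zero => exact hr
    | succ k => exact h k

/-- `B` is represented by a system all of whose state sets are in `C`. -/
def OpenRep {X : Type*} [TopologicalSpace X] (C : Set X → Prop) (B : Set X) : Prop :=
  ∃ U : ℕ → ℕ → Set X, (∀ q r, IsOpen (U q r)) ∧ PP U 0 = B ∧ ∀ q, C (PP U q)

theorem OpenRep.of_countable {X : Type*} [TopologicalSpace X] {C : Set X → Prop} {B : Set X}
    {Q : Type*} [Countable Q] (q₀ : Q) (U : Q → Q → Set X) (hU : ∀ q r, IsOpen (U q r))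
    (hB : PP U q₀ = B) (hC : ∀ q, C (PP U q)) : OpenRep C B := by
  have : Nonempty Q := ⟨q₀⟩
  obtain ⟨g₀, hg₀⟩ := exists_surjective_nat Q
  let g : ℕ → Q := fun n => Nat.casesOn n q₀ g₀
  have hg : Function.Surjective g := fun q => by
    obtain ⟨n, hn⟩ := hg₀ q
    exact ⟨n + 1, hn⟩
  choose s hs using hg
  have key : ∀ n, PP (fun a b => U (g a) (g b)) n = PP U (g n) := by
    intro n
    ext y
    constructor
    · rintro ⟨σ, h0, h⟩
      exact ⟨fun i => g (σ i), by simp [h0], h⟩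
    · rintro ⟨σ, h0, h⟩
      refine ⟨fun i => Nat.casesOn i n (fun j => s (σ (j + 1))), rfl, fun i => ?_⟩
      cases i with
      | zero => simpa [hs, h0] using h 0
      | succ i => simpa [hs] using h (i + 1)
  refine ⟨fun a b => U (g a) (g b), fun _ _ => hU _ _, ?_, fun q => ?_⟩
  · rw [key]; exact hB
  · rw [key]; exact hC _

theorem OpenRep.iUnion {X : Type*} [TopologicalSpace X] {C : Set X → Prop} {f : ℕ → Set X}
    (D : ℕ → Set X → Prop) (h : ∀ n, OpenRep (D n) (f n)) (hD : ∀ n s, D n s → C s)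
    (hC : C (⋃ n, f n)) : OpenRep C (⋃ n, f n) := by
  choose U hU h0 hP using h
  let W : Option (ℕ × ℕ) → Option (ℕ × ℕ) → Set X := fun a b =>
    match a, b with
    | none, some (_, q) => {_y | q = 0}
    | some (n, q), some (m, r) => {y | n = m ∧ y ∈ U n q r}
    | _, none => ∅
  have h1 : ∀ n q, PP W (some (n, q)) = PP (U n) q := by
    intro n q
    ext y
    constructor
    · rintro ⟨σ, hσ, h⟩
      have : ∀ i, ∃ r, σ i = some (n, r) := by
        intro i
        induction i with
        | zero => exact ⟨q, hσ⟩
        | succ i ih =>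
          obtain ⟨r, hr⟩ := ih
          have := h i
          rw [hr] at this
          rcases hi : σ (i + 1) with _ | ⟨m, r'⟩
          · rw [hi] at this; exact absurd this (by simp [W])
          · rw [hi] at this
            obtain ⟨rfl, _⟩ := this
            exact ⟨r', rfl⟩
      choose τ hτ using this
      refine ⟨τ, ?_, fun i => ?_⟩
      · have := hτ 0; rw [hσ] at this; simpa using this.symm
      · have := h i
        rw [hτ, hτ] at this
        exact this.2
    · rintro ⟨σ, hσ, h⟩
      exact ⟨fun i => some (n, σ i), by simp [hσ], fun i => ⟨rfl, h i⟩⟩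
  have h2 : PP W none = ⋃ n, f n := by
    ext y
    rw [PP_step, mem_iUnion]
    constructor
    · rintro ⟨_ | ⟨n, q⟩, hr, hy⟩
      · exact absurd hr (by simp [W])
      · obtain rfl : q = 0 := hr
        rw [h1, h0] at hy
        exact ⟨n, hy⟩
    · rintro ⟨n, hy⟩
      exact ⟨some (n, 0), rfl, by rw [h1, h0]; exact hy⟩
  refine OpenRep.of_countable none W ?_ h2 ?_
  · rintro (_ | ⟨n, q⟩) (_ | ⟨m, r⟩)
    · exact isOpen_empty
    · exact isOpen_const
    · exact isOpen_empty
    · exact isOpen_const.and (hU n q r)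
  · rintro (_ | ⟨n, q⟩)
    · rw [h2]; exact hC
    · rw [h1]; exact hD n _ (hP n q)

theorem OpenRep.iInter {X : Type*} [TopologicalSpace X] {C : Set X → Prop} {f : ℕ → Set X}
    (D : ℕ → Set X → Prop) (h : ∀ n, OpenRep (D n) (f n))
    (hC : ∀ s : ℕ → Set X, (∀ n, D n (s n)) → C (⋂ n, s n)) : OpenRep C (⋂ n, f n) := by
  choose U hU h0 hP using h
  let W : List ℕ → List ℕ → Set X := fun l l' =>
    {y | (l'.length = l.length + 1 ∧ ∀ i, l.length ≤ i → l'.getD i 0 = l.getD i 0) ∧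
      ∀ i ∈ Finset.range l.length, y ∈ U i (l.getD i 0) (l'.getD i 0)}
  have h1 : ∀ l, PP W l = ⋂ i, PP (U i) (l.getD i 0) := by
    intro l
    ext y
    rw [mem_iInter]
    constructor
    · rintro ⟨τ, hτ, h⟩ i
      have hlen : ∀ k, (τ k).length = l.length + k := by
        intro k
        induction k with
        | zero => simp [hτ]
        | succ k ih => rw [(h k).1.1, ih]; omega
      have hst : ∀ m, m ≤ i + 1 - l.length → (τ m).getD i 0 = l.getD i 0 := by
        intro m
        induction m with
        | zero => simp [hτ]
        | succ m ih =>
          intro hm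
          rw [(h m).1.2 i (by rw [hlen]; omega), ih (by omega)]
      refine ⟨fun k => (τ (i + 1 - l.length + k)).getD i 0, hst _ le_rfl, fun k => ?_⟩
      exact (h (i + 1 - l.length + k)).2 i (by rw [Finset.mem_range, hlen]; omega)
    · intro hy
      choose σ hσ0 hσ using hy
      let τ : ℕ → List ℕ := fun k =>
        List.ofFn fun i : Fin (l.length + k) => σ i (k - (i + 1 - l.length))
      have hlen : ∀ k, (τ k).length = l.length + k := by intro k; simp [τ]
      have hin : ∀ k i, i < l.length + k →
          (τ k).getD i 0 = σ i (k - (i + 1 - l.length)) := by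
        intro k i hi
        have hi' : i < (τ k).length := by rw [hlen]; exact hi
        rw [List.getD_eq_getElem _ _ hi']
        simp [τ]
      have hout : ∀ k i, l.length + k ≤ i → (τ k).getD i 0 = 0 := by
        intro k i hi
        rw [List.getD_eq_default]
        rw [hlen]; exact hi
      refine ⟨τ, ?_, fun k => ⟨⟨by rw [hlen, hlen]; omega, ?_⟩, ?_⟩⟩
      · apply List.ext_getElem
        · simp [hlen]
        · intro i hi1 hi2
          simp only [τ, List.getElem_ofFn, Nat.zero_sub]
          rw [hσ0, List.getD_eq_getElem _ _ hi2]
      · intro i hi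
        rw [hlen] at hi
        rw [hout k i hi]
        rcases hi.eq_or_lt with rfl | hi'
        · rw [hin _ _ (by omega)]
          have : k + 1 - (l.length + k + 1 - l.length) = 0 := by omega
          rw [this, hσ0, List.getD_eq_default]
          omega
        · exact hout _ _ (by omega)
      · intro i hi
        rw [Finset.mem_range, hlen] at hi
        rw [hin k i hi, hin (k + 1) i (by omega)]
        have : k + 1 - (i + 1 - l.length) = k - (i + 1 - l.length) + 1 := by omega
        rw [this]
        exact hσ i _
  refine OpenRep.of_countable [] W ?_ ?_ ?_
  · intro l l'
    refine IsOpen.and isOpen_const ?_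
    have : {y | ∀ i ∈ Finset.range l.length, y ∈ U i (l.getD i 0) (l'.getD i 0)} =
        ⋂ i ∈ Finset.range l.length, U i (l.getD i 0) (l'.getD i 0) := by
      ext y; simp
    rw [this]
    exact isOpen_biInter_finset fun i _ => hU _ _ _
  · rw [h1]
    simp [h0]
  · intro l
    rw [h1]
    exact hC _ fun n => hP n _

theorem rep_of_sigma {Y : Type*} [TopologicalSpace Y] [DiscreteTopology Y]
    {ξ : Ordinal.{0}} {B : Set (ℕ → Y)} (h : SigmaO ξ B) :
    OpenRep (SigmaO ξ) B ∧ OpenRep (fun s => SigmaO ξ sᶜ) Bᶜ := by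
  induction h with
  | isOpen B hB =>
    constructor
    · have : ∀ q, PP (fun _ _ : ℕ => B) q = B := by
        intro q
        ext y
        exact ⟨fun ⟨_, _, h⟩ => h 0, fun h => ⟨fun _ => q, rfl, fun _ => h⟩⟩
      exact ⟨fun _ _ => B, fun _ _ => hB, this 0, fun q => by rw [this]; exact .isOpen _ hB⟩
    · let U : ℕ → ℕ → Set (ℕ → Y) := fun n m => {y | m = n + 1 ∧ y ∈ (appr B n)ᶜ}
      have key : ∀ q, PP U q = Bᶜ := by
        intro q
        ext y
        rw [← iUnion_appr hB, compl_iUnion, mem_iInter]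
        constructor
        · rintro ⟨σ, h0, h⟩ n
          have hs : ∀ i, σ i = q + i := by
            intro i
            induction i with
            | zero => exact h0
            | succ i ih => rw [(h i).1, ih]; rfl
          intro hn
          refine (h n).2 (appr_mono ?_ hn)
          rw [hs]; omega
        · intro hy
          exact ⟨fun i => q + i, rfl, fun i => ⟨rfl, hy _⟩⟩
      refine ⟨U, fun q r => ?_, key 0, fun q => ?_⟩
      · exact isOpen_const.and (isClopen_appr B q).compl.2
      · rw [key]; exact .isOpen _ (by simpa using hB)
  | iUnion ξ hξ f g hg hf ih =>
    constructor
    · refine OpenRep.iUnion (fun n s => SigmaO (g n) sᶜ) (fun n => ?_) (fun n s hs => ?_)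
        (.iUnion ξ hξ f g hg hf)
      · have := (ih n).2
        rwa [compl_compl] at this
      · exact .of_compl hs (hg n)
    · rw [compl_iUnion]
      refine OpenRep.iInter (fun n s => SigmaO (g n) s) (fun n => (ih n).1) fun s hs => ?_
      rw [compl_iInter]
      exact .iUnion ξ hξ _ g hg fun n => by simpa using hs n

/-! ### Complete sets -/

/-- Every `Σ⁰_ξ` set over a finite alphabet reduces to `B`. -/
def Hard (ξ : Ordinal.{0}) (B : Set (ℕ → Bool)) : Prop :=
  ∀ (Y : Type) [Fintype Y] [TopologicalSpace Y] [DiscreteTopology Y]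
    (E : Set (ℕ → Y)), SigmaO ξ E → ∃ f : (ℕ → Y) → (ℕ → Bool), Continuous f ∧ E = f ⁻¹' B

theorem exists_complete (ξ : Ordinal.{0}) (hξ : 1 ≤ ξ) (hc : ξ.card ≤ Cardinal.aleph0) :
    ∃ B, SigmaO ξ B ∧ Hard ξ B := by
  classical
  induction ξ using WellFoundedLT.induction with
  | ind ξ ih =>
  rcases hξ.eq_or_lt with rfl | hξ1
  · refine ⟨{x | ∃ n, x n = true}, .isOpen _ ?_, ?_⟩
    · have : {x : ℕ → Bool | ∃ n, x n = true} = ⋃ n, {x | x n = true} := by ext; simp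
      rw [this]
      exact isOpen_iUnion fun n =>
        isOpen_of_dep (n + 1) fun x z h hx => by
          simpa [h n (by omega)] using hx
    · intro Y _ _ _ E hE
      refine ⟨fun y n => decide (y ∈ appr E n), continuous_pi fun n =>
        continuous_of_dep ⟨n, fun x z h => ?_⟩, ?_⟩
      · have : x ∈ appr E n ↔ z ∈ appr E n :=
          ⟨appr_dep x z h, appr_dep z x fun i hi => (h i hi).symm⟩
        simp [this]
      · ext y
        nth_rw 1 [← iUnion_appr hE.one]
        simp
  · let I := {γ : Ordinal.{0} // 1 ≤ γ ∧ γ < ξ}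
    have : Nonempty I := ⟨⟨1, le_rfl, hξ1⟩⟩
    have : Countable I := by
      have hcI : (Set.Iio ξ).Countable := by
        rw [← Cardinal.le_aleph0_iff_set_countable, Cardinal.mk_Iio_ordinal]
        exact Cardinal.lift_le_aleph0.2 hc
      exact (hcI.mono (s₁ := {γ | 1 ≤ γ ∧ γ < ξ}) fun γ h => h.2).to_subtype
    obtain ⟨e, he⟩ := exists_surjective_nat I
    choose B hB hH using fun n => ih (e n).1 (e n).2.2 (e n).2.1
      ((Ordinal.card_le_card (e n).2.2.le).trans hc)
    let pr : ℕ → (ℕ → Bool) → (ℕ → Bool) := fun m x i => x (Nat.pair m i)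
    have hpr : ∀ m, Continuous (pr m) := fun m =>
      continuous_pi fun i => continuous_apply (A := fun _ : ℕ => Bool) (Nat.pair m i)
    refine ⟨⋃ m, (pr m ⁻¹' (B m.unpair.1))ᶜ, .iUnion ξ hξ1 _ (fun m => (e m.unpair.1).1)
      (fun m => (e m.unpair.1).2.2) (fun m => ?_), ?_⟩
    · rw [compl_compl]
      exact (hB _).preimage (hpr m)
    · intro Y _ _ _ E hE
      obtain ⟨f, g, hg, hf, rfl⟩ := hE.exists_iUnion hξ1
      have : ∀ m : ℕ, ∃ h : (ℕ → Y) → (ℕ → Bool), Continuous h ∧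
          (if g m.unpair.2 = (e m.unpair.1).1 then (f m.unpair.2)ᶜ else Set.univ) =
            h ⁻¹' (B m.unpair.1) := by
        intro m
        apply hH
        split_ifs with hm
        · rw [← hm]; exact hf _
        · exact .univ (e m.unpair.1).2.1
      choose h hcont hh using this
      refine ⟨fun y n => h n.unpair.1 y n.unpair.2, ?_, ?_⟩
      · exact continuous_pi fun n =>
          (continuous_apply (A := fun _ : ℕ => Bool) n.unpair.2).comp (hcont n.unpair.1)
      · have hprh : ∀ m y, pr m (fun n => h n.unpair.1 y n.unpair.2) = h m y := by
          intro m y; funext i; simp [pr]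
        ext y
        simp only [mem_iUnion, mem_preimage, mem_compl_iff, hprh]
        have hmem : ∀ m, h m y ∈ B m.unpair.1 ↔
            y ∈ (if g m.unpair.2 = (e m.unpair.1).1 then (f m.unpair.2)ᶜ else Set.univ) := by
          intro m; rw [hh]; rfl
        simp only [hmem]
        constructor
        · rintro ⟨k, hk⟩
          obtain ⟨n, hn⟩ := he ⟨g k, (hf k).pos, hg k⟩
          refine ⟨Nat.pair n k, ?_⟩
          simp [hn, hk]
        · rintro ⟨m, hm⟩
          split_ifs at hm with h'
          · exact ⟨_, by simpa using hm⟩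
          · exact absurd (mem_univ _) hm

/-! ### The coding -/

/-- A code of the prefix of length `l`. -/
def cd (Y : ℕ → Bool) (l : ℕ) : ℕ := Nat.pair l (Encodable.encode (pre Y l))

theorem le_cd (Y : ℕ → Bool) (l : ℕ) : l ≤ cd Y l := Nat.left_le_pair _ _

theorem cd_inj {Y Z : ℕ → Bool} {l k : ℕ} :
    cd Y l = cd Z k ↔ l = k ∧ ∀ i < l, Y i = Z i := by
  unfold cd
  rw [Nat.pair_eq_pair, Encodable.encode_inj, pre_inj]
  tauto

/-- One step of the emitting automaton. -/
def stp (Y : ℕ → Bool) (s : ℕ × ℕ) : ℕ × ℕ :=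
  if s.2 = cd Y (s.1 + 1) then (s.1 + 1, 0) else (s.1, s.2 + 1)

/-- The state after `n` steps. -/
def st (Y : ℕ → Bool) (s : ℕ × ℕ) (n : ℕ) : ℕ × ℕ := (stp Y)^[n] s

/-- The symbol emitted in a state. -/
def emi (Y : ℕ → Bool) (s : ℕ × ℕ) : Bool := decide (s.2 ≠ cd Y (s.1 + 1))

/-- The emitted infinite word. -/
def out (Y : ℕ → Bool) (s : ℕ × ℕ) : ℕ → Bool := fun n => emi Y (st Y s n)

/-- Valid states. -/
def Valid (Y : ℕ → Bool) (s : ℕ × ℕ) : Prop := s.2 ≤ cd Y (s.1 + 1)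

theorem st_zero (Y s) : st Y s 0 = s := rfl

theorem st_succ (Y s n) : st Y s (n + 1) = stp Y (st Y s n) :=
  Function.iterate_succ_apply' _ _ _

theorem st_add (Y s a b) : st Y s (a + b) = st Y (st Y s a) b := by
  unfold st
  rw [add_comm, Function.iterate_add_apply]

theorem tl_out (Y s a) : tl a (out Y s) = out Y (st Y s a) := by
  funext i
  simp only [tl, out, st_add]

theorem Valid.stp {Y s} (h : Valid Y s) : Valid Y (stp Y s) := by
  unfold Valid _root_.stp at *
  split_ifs with h1
  · exact Nat.zero_le _
  · simp only; omega

theorem Valid.st {Y s} (h : Valid Y s) (n : ℕ) : Valid Y (st Y s n) := by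
  induction n with
  | zero => exact h
  | succ n ih => rw [st_succ]; exact ih.stp

theorem valid_zero (Y l) : Valid Y (l, 0) := Nat.zero_le _

theorem stp_mono (Y s) : s.1 ≤ (stp Y s).1 := by
  unfold stp; split_ifs <;> simp

theorem stp_le (Y s) : (stp Y s).1 ≤ s.1 + 1 := by
  unfold stp; split_ifs <;> simp

theorem st_mono (Y s) {a b : ℕ} (h : a ≤ b) : (st Y s a).1 ≤ (st Y s b).1 := by
  induction b, h using Nat.le_induction with
  | base => exact le_rfl
  | succ b _ ih => rw [st_succ]; exact ih.trans (stp_mono _ _)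

theorem st_le (Y s n) : (st Y s n).1 ≤ s.1 + n := by
  induction n with
  | zero => exact le_rfl
  | succ n ih => rw [st_succ]; have := stp_le Y (st Y s n); omega

theorem st_phase {Y s n} (h : s.2 + n ≤ cd Y (s.1 + 1)) : st Y s n = (s.1, s.2 + n) := by
  induction n with
  | zero => rfl
  | succ n ih =>
    rw [st_succ, ih (by omega), stp, if_neg (by simp only; omega)]
    rfl

theorem st_next {Y s} (h : Valid Y s) :
    st Y s (cd Y (s.1 + 1) - s.2 + 1) = (s.1 + 1, 0) := by
  unfold Valid at h
  rw [st_succ, st_phase (by omega), stp, if_pos (by simp only; omega)]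

theorem out_one {Y s i} (hi : i < cd Y (s.1 + 1) - s.2) : out Y s i = true := by
  unfold out emi
  rw [st_phase (by omega)]
  simp only [decide_eq_true_eq, ne_eq]
  omega

theorem out_zero {Y s} (h : Valid Y s) : out Y s (cd Y (s.1 + 1) - s.2) = false := by
  unfold Valid at h
  unfold out emi
  rw [st_phase (by omega)]
  simp only [ne_eq, decide_not, Bool.not_eq_false', decide_eq_true_eq]
  omega

theorem reach_state {Y s l q} (h : Valid Y s) (hl : s.1 < l) (hq : q ≤ cd Y (l + 1)) :
    ∃ n, st Y s n = (l, q) := by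
  have : ∀ l, s.1 < l → ∃ n, st Y s n = (l, 0) := by
    intro l hl
    induction l, hl using Nat.le_induction with
    | base => exact ⟨_, st_next h⟩
    | succ l _ ih =>
      obtain ⟨n, hn⟩ := ih
      refine ⟨n + (cd Y (l + 1) - 0 + 1), ?_⟩
      rw [st_add, hn]
      exact st_next (valid_zero Y l)
  obtain ⟨n, hn⟩ := this l hl
  refine ⟨n + q, ?_⟩
  rw [st_add, hn, st_phase (by simpa using hq)]
  simp

theorem first_zero {Y Z s t n} (hs : Valid Y s) (ht : Valid Z t)
    (h : ∀ i < n, out Y s i = out Z t i) (hn : cd Y (s.1 + 1) - s.2 < n) :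
    cd Y (s.1 + 1) - s.2 = cd Z (t.1 + 1) - t.2 := by
  rcases lt_trichotomy (cd Y (s.1 + 1) - s.2) (cd Z (t.1 + 1) - t.2) with h1 | h1 | h1
  · have h2 := out_one h1
    rw [← h _ hn, out_zero hs] at h2
    exact absurd h2 (by simp)
  · exact h1
  · have h2 := out_one h1
    rw [h _ (h1.trans hn), out_zero ht] at h2
    exact absurd h2 (by simp)

theorem determinacy {Y Z s t n} (hs : Valid Y s) (ht : Valid Z t)
    (h : ∀ i < n, out Y s i = out Z t i) (hn : s.1 + 2 ≤ (st Y s n).1) :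
    s = t ∧ ∀ i < s.1, Y i = Z i := by
  have hlt : cd Y (s.1 + 1) - s.2 + 1 + cd Y (s.1 + 2) < n := by
    by_contra hcon
    have h1 := st_mono Y s (not_lt.1 hcon)
    have h2 : st Y (s.1 + 1, 0) (cd Y (s.1 + 2)) = (s.1 + 1, 0 + cd Y (s.1 + 2)) :=
      st_phase (Y := Y) (s := (s.1 + 1, 0)) (n := cd Y (s.1 + 2)) (Nat.zero_add _).le
    rw [st_add Y s (cd Y (s.1 + 1) - s.2 + 1) (cd Y (s.1 + 2)), st_next hs, h2] at h1
    simp only at h1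
    omega
  have e1 := first_zero hs ht h (by omega)
  have e2 := first_zero (Y := Y) (Z := Z) (s := (s.1 + 1, 0)) (t := (t.1 + 1, 0))
    (n := cd Y (s.1 + 2) + 1) (valid_zero _ _) (valid_zero _ _) (fun i hi => by
      have h1 := h (cd Y (s.1 + 1) - s.2 + 1 + i) (by omega)
      have h2 := congrFun (tl_out Y s (cd Y (s.1 + 1) - s.2 + 1)) i
      have h3 := congrFun (tl_out Z t (cd Z (t.1 + 1) - t.2 + 1)) i
      rw [st_next hs] at h2
      rw [st_next ht] at h3
      rw [← h2, ← h3, ← e1]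
      exact h1) (by simp)
  simp only [Nat.sub_zero] at e2
  obtain ⟨h1, h2⟩ := cd_inj.1 e2
  have h3 : s.1 = t.1 := by omega
  have h4 : cd Y (s.1 + 1) = cd Z (t.1 + 1) :=
    cd_inj.2 ⟨by omega, fun i hi => h2 i (by omega)⟩
  unfold Valid at hs ht
  exact ⟨Prod.ext h3 (by omega), fun i hi => h2 i (by omega)⟩

theorem agree_states {Y Z s n} (hY : ∀ i < s.1, Y i = Z i)
    (h : ∀ i < n, out Y s i = out Z s i) :
    st Y s n = st Z s n ∧ ∀ i < (st Y s n).1, Y i = Z i := by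
  induction n with
  | zero => exact ⟨rfl, hY⟩
  | succ n ih =>
    obtain ⟨h1, h2⟩ := ih fun i hi => h i (by omega)
    have h3 := h n (by omega)
    unfold out emi at h3
    rw [← h1] at h3
    rw [st_succ, st_succ, ← h1]
    generalize st Y s n = r at *
    have h4 : (r.2 = cd Y (r.1 + 1)) ↔ (r.2 = cd Z (r.1 + 1)) := by
      simpa using h3
    unfold stp
    by_cases h5 : r.2 = cd Y (r.1 + 1)
    · rw [if_pos h5, if_pos (h4.1 h5)]
      exact ⟨rfl, (cd_inj.1 (h5.symm.trans (h4.1 h5))).2⟩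
    · rw [if_neg h5, if_neg (fun h => h5 (h4.2 h))]
      exact ⟨rfl, h2⟩

theorem st_dep {Y Z s n} (h : ∀ i < s.1 + n, Y i = Z i) : st Y s n = st Z s n := by
  induction n with
  | zero => rfl
  | succ n ih =>
    have h1 := ih fun i hi => h i (by omega)
    rw [st_succ, st_succ, ← h1]
    have h2 := st_le Y s n
    have : cd Y ((st Y s n).1 + 1) = cd Z ((st Y s n).1 + 1) :=
      cd_inj.2 ⟨rfl, fun i hi => h i (by omega)⟩
    unfold stp
    rw [this]

theorem out_dep {Y Z s n} (h : ∀ i < s.1 + n + 1, Y i = Z i) : out Y s n = out Z s n := by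
  have h1 := st_dep (s := s) (n := n) fun i hi => h i (by omega)
  have h2 := st_le Y s n
  unfold out emi
  rw [← h1]
  have : cd Y ((st Y s n).1 + 1) = cd Z ((st Y s n).1 + 1) :=
    cd_inj.2 ⟨rfl, fun i hi => h i (by omega)⟩
  rw [this]

theorem continuous_out (s) : Continuous (fun Y => out Y s) :=
  continuous_pi fun n => continuous_of_dep ⟨s.1 + n + 1, fun _ _ h => out_dep h⟩

theorem out_injective (l : ℕ) : Function.Injective (fun Y => out Y (l, 0)) := by
  intro Y Z h
  simp only at h
  funext i
  have key : ∀ k, st Y (l, 0) (cd Y (l + 1) + 1 + k) = st Z (l, 0) (cd Y (l + 1) + 1 + k) ∧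
      ∀ i < (st Y (l, 0) (cd Y (l + 1) + 1 + k)).1, Y i = Z i := by
    have e := first_zero (valid_zero Y l) (valid_zero Z l)
      (n := cd Y (l + 1) + 1) (fun i _ => congrFun h i) (by simp)
    simp only [Nat.sub_zero] at e
    intro k
    have hY := st_next (valid_zero Y l)
    have hZ := st_next (valid_zero Z l)
    simp only [Nat.sub_zero] at hY hZ
    have hZ2 : st Z (l, 0) (cd Y (l + 1) + 1) = (l + 1, 0) := by rw [e]; exact hZ
    rw [st_add Y (l, 0) (cd Y (l + 1) + 1) k, st_add Z (l, 0) (cd Y (l + 1) + 1) k, hY, hZ2]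
    apply agree_states
    · exact (cd_inj.1 e).2
    · intro i _
      have h3 := tl_out Y (l, 0) (cd Y (l + 1) + 1)
      rw [h, tl_out, hY, hZ2] at h3
      rw [h3]
  obtain ⟨n, hn⟩ := reach_state (valid_zero Y l) (l := l + i + 1) (q := 0) (by simp only; omega)
    (Nat.zero_le _)
  have h1 := st_mono Y (l, 0) (a := n) (b := cd Y (l + 1) + 1 + n) (by omega)
  rw [hn] at h1
  exact (key n).2 i (by simp only at h1; omega)

/-- The blocks of the language. -/
def QQ (U : ℕ → ℕ → Set (ℕ → Bool)) (x : ℕ → Bool) (n : ℕ) : Prop :=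
  ∃ Y s, Valid Y s ∧ x = out Y s ∧ s.1 + 2 ≤ (st Y s n).1 ∧
    Y ∈ appr (U s.2 (st Y s n).2) (st Y s n).1

theorem blk_QQ {U : ℕ → ℕ → Set (ℕ → Bool)} {x a b} :
    Blk (lang (QQ U)) x a b ↔ a < b ∧ ∃ Y s, Valid Y s ∧ (∀ i < b - a, tl a x i = out Y s i) ∧
      s.1 + 2 ≤ (st Y s (b - a)).1 ∧
      Y ∈ appr (U s.2 (st Y s (b - a)).2) (st Y s (b - a)).1 := by
  unfold Blk
  rw [pre_mem_lang]
  constructor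
  · rintro ⟨h, z, hz, Y, s, h1, rfl, h2⟩
    exact ⟨h, Y, s, h1, hz, h2⟩
  · rintro ⟨h, Y, s, h1, hz, h2⟩
    exact ⟨h, _, hz, Y, s, h1, rfl, h2⟩

theorem out_mem_iff {U : ℕ → ℕ → Set (ℕ → Bool)} (hU : ∀ q r, IsOpen (U q r)) {Y s}
    (hs : Valid Y s) : out Y s ∈ omegaPower (lang (QQ U)) ↔ Y ∈ PP U s.2 := by
  rw [mem_omegaPower]
  constructor
  · rintro ⟨f, h0, hf⟩
    refine ⟨fun k => (st Y s (f k)).2, by simp [h0, st_zero], fun k => ?_⟩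
    obtain ⟨hlt, Z, t, ht, hag, hl, hz⟩ := blk_QQ.1 (hf k)
    rw [tl_out] at hag
    obtain ⟨rfl, h1⟩ := determinacy ht (hs.st (f k)) (fun i hi => (hag i hi).symm) hl
    obtain ⟨h2, h3⟩ := agree_states h1 fun i hi => (hag i hi).symm
    rw [h2, ← st_add, Nat.add_sub_cancel' hlt.le] at hz
    rw [h2, ← st_add, Nat.add_sub_cancel' hlt.le] at h3
    exact hz Y h3
  · rintro ⟨σ, h0, hσ⟩
    have step : ∀ a : {a : ℕ × ℕ // (st Y s a.1).2 = σ a.2},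
        ∃ b : {a : ℕ × ℕ // (st Y s a.1).2 = σ a.2}, b.1.2 = a.1.2 + 1 ∧
          Blk (lang (QQ U)) (out Y s) a.1.1 b.1.1 := by
      rintro ⟨⟨p, i⟩, hp⟩
      simp only at hp
      obtain ⟨m, hm⟩ := exists_dep (hU _ _) (hσ i)
      obtain ⟨n, hn⟩ := reach_state (hs.st p)
        (l := (st Y s p).1 + 2 + m + σ (i + 1)) (q := σ (i + 1)) (by omega)
        (by have := le_cd Y ((st Y s p).1 + 2 + m + σ (i + 1) + 1); omega)
      have hn0 : n ≠ 0 := by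
        rintro rfl
        have := congrArg Prod.fst hn
        rw [st_zero] at this
        simp only at this
        omega
      refine ⟨⟨(p + n, i + 1), by simp only; rw [st_add, hn]⟩, rfl, ?_⟩
      rw [blk_QQ]
      refine ⟨by simp only; omega, Y, st Y s p, hs.st p, fun j _ => by rw [tl_out], ?_⟩
      simp only [Nat.add_sub_cancel_left]
      rw [hn, hp]
      exact ⟨by simp only; omega, fun z hz => hm z fun j hj => hz j (by simp only; omega)⟩
    choose nx hnx1 hnx2 using step
    let a₀ : {a : ℕ × ℕ // (st Y s a.1).2 = σ a.2} := ⟨(0, 0), by simp [st_zero, h0]⟩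
    refine ⟨fun k => (nx^[k] a₀).1.1, rfl, fun k => ?_⟩
    simp only [Function.iterate_succ_apply']
    exact hnx2 _

/-- The points which are eventually well coded. -/
def KK (p l : ℕ) : Set (ℕ → Bool) := {x | ∃ Y, tl p x = out Y (l, 0)}

theorem continuous_tl (p : ℕ) : Continuous (tl p : (ℕ → Bool) → (ℕ → Bool)) :=
  continuous_pi fun i => continuous_apply (A := fun _ : ℕ => Bool) (p + i)

theorem isClosed_KK (p l : ℕ) : IsClosed (KK p l) := by
  have : KK p l = tl p ⁻¹' (Set.range fun Y => out Y (l, 0)) := by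
    ext x
    simp [KK, eq_comm]
  rw [this]
  exact (isCompact_range (continuous_out _)).isClosed.preimage (continuous_tl p)

theorem exists_KK_of_infinite {U : ℕ → ℕ → Set (ℕ → Bool)} {x a}
    (h : {b | Blk (lang (QQ U)) x a b}.Infinite) : ∃ p l, x ∈ KK p l := by
  obtain ⟨b₀, hb₀⟩ := h.nonempty
  obtain ⟨hlt₀, Y₀, s, hs, hag₀, hl₀, -⟩ := blk_QQ.1 hb₀
  have key : ∀ n, ∃ Z ∈ {Z | Valid Z s}, ∀ i < n, tl a x i = out Z s i := by
    intro n
    obtain ⟨b, hb, hbn⟩ := h.exists_gt (b₀ + n + a)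
    obtain ⟨hlt, Z, t, ht, hag, -⟩ := blk_QQ.1 hb
    obtain ⟨rfl, -⟩ := determinacy hs ht (n := b₀ - a)
      (fun i hi => (hag₀ i hi).symm.trans (hag i (by omega))) hl₀
    exact ⟨Z, ht, fun i hi => hag i (by omega)⟩
  have hcl : IsClosed ((fun Z => out Z s) '' {Z | Valid Z s}) := by
    have h1 : IsClosed {Z | Valid Z s} := by
      refine (isClopen_of_dep (s.1 + 1) fun Y Z hYZ hY => ?_).1
      have : cd Y (s.1 + 1) = cd Z (s.1 + 1) := cd_inj.2 ⟨rfl, hYZ⟩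
      simp only [mem_ofPred_eq, Valid] at *
      rwa [← this]
    exact (h1.isCompact.image (continuous_out s)).isClosed
  have hmem : tl a x ∈ closure ((fun Z => out Z s) '' {Z | Valid Z s}) :=
    mem_closure_of_dep fun n => by
      obtain ⟨Z, hZ, hz⟩ := key n
      exact ⟨_, ⟨Z, hZ, rfl⟩, hz⟩
  rw [hcl.closure_eq] at hmem
  obtain ⟨Y, hY, hYx⟩ := hmem
  refine ⟨a + (cd Y (s.1 + 1) - s.2 + 1), s.1 + 1, Y, ?_⟩
  rw [← tl_tl, ← hYx]
  simp only
  rw [tl_out, st_next hY]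

theorem sigma_omegaPower {ξ : Ordinal.{0}} (hξ : 2 < ξ) {U : ℕ → ℕ → Set (ℕ → Bool)}
    (hU : ∀ q r, IsOpen (U q r)) (hP : ∀ q, SigmaO ξ (PP U q)) :
    SigmaO ξ (omegaPower (lang (QQ U))) := by
  have h12 : (1 : Ordinal.{0}) < 2 := by norm_num
  have hξ1 : 1 < ξ := h12.trans hξ
  set V := lang (QQ U) with hV
  have hreach : ∀ p, IsClopen {x | Reach V x p} := fun p =>
    isClopen_of_dep p fun x z hxz hx => Reach.congr hx fun i hi => (hxz i hi).symm
  -- the points which are not eventually well coded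
  let G : Set (ℕ → Bool) :=
    ((⋃ N, ⋂ p, ⋂ (_ : N ≤ p), {x | Reach V x p}ᶜ) ∪ ⋃ p : ℕ × ℕ, KK p.1 p.2)ᶜ
  have hG : SigmaO ξ G := by
    refine .of_compl (η := 2) ?_ hξ
    simp only [G, compl_compl]
    refine .union h12 (.iUnion' h12 fun N => .of_isClosed ?_ h12)
      (.iUnion_countable h12 fun p => .of_isClosed (isClosed_KK _ _) h12)
    exact isClosed_iInter fun p => isClosed_iInter fun _ => (hreach p).compl.1
  have hGV : G ⊆ omegaPower V := by
    intro x hx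
    simp only [G, mem_compl_iff, mem_union, mem_iUnion, mem_iInter, not_or, not_exists,
      not_forall, mem_ofPred_eq, not_not] at hx
    rw [mem_omegaPower]
    refine konig (fun a => ?_) (fun N => ?_)
    · by_contra hinf
      obtain ⟨p, l, h⟩ := exists_KK_of_infinite hinf
      exact hx.2 (p, l) h
    · obtain ⟨p, hp, h⟩ := hx.1 N
      exact ⟨p, hp, h⟩
  have hemb : ∀ l, Topology.IsInducing (fun Y => out Y (l, 0)) := fun l =>
    ((continuous_out (l, 0)).isClosedEmbedding (out_injective l)).isInducing
  have hD : ∀ l n q, ∃ t : Set (ℕ → Bool), SigmaO ξ t ∧ (fun Y => out Y (l, 0)) ⁻¹' t =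
      PP U q ∩ {Y | (st Y (l, 0) n).2 = q} := by
    intro l n q
    refine SigmaO.exists_preimage (hemb l) ((hP q).inter_isClosed hξ1 ?_)
    refine (isClopen_of_dep (l + n) fun Y Z h hY => ?_).1
    have := st_dep (s := (l, 0)) (n := n) h
    simp only [mem_ofPred_eq] at *
    rwa [← this]
  choose t ht htp using hD
  have hmain : omegaPower V = G ∪ ⋃ p : (ℕ × ℕ) × (ℕ × ℕ),
      ((tl p.1.1 ⁻¹' t p.1.2 p.2.1 p.2.2) ∩ (KK p.1.1 p.1.2 ∩
        {x | Reach V x (p.1.1 + p.2.1)})) := by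
    have key : ∀ x p l n q Y, tl p x = out Y (l, 0) → (x ∈ tl p ⁻¹' t l n q ↔
        (st Y (l, 0) n).2 = q ∧ tl (p + n) x ∈ omegaPower V) := by
      intro x p l n q Y hY
      have h1 : x ∈ tl p ⁻¹' t l n q ↔ Y ∈ PP U q ∩ {Y | (st Y (l, 0) n).2 = q} := by
        rw [← htp, mem_preimage, mem_preimage, hY]
      rw [h1, ← tl_tl, hY, tl_out, out_mem_iff hU ((valid_zero Y l).st n)]
      constructor
      · rintro ⟨h2, rfl⟩
        exact ⟨rfl, h2⟩
      · rintro ⟨rfl, h2⟩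
        exact ⟨h2, rfl⟩
    apply Subset.antisymm
    · intro x hx
      by_cases hxG : x ∈ G
      · exact Or.inl hxG
      · right
        rw [mem_omegaPower] at hx
        rw [notMem_compl_iff] at hxG
        rcases hxG with hxG | hxG
        · simp only [mem_iUnion, mem_iInter] at hxG
          obtain ⟨N, hN⟩ := hxG
          obtain ⟨p, hp, hr, -⟩ := hx.reach N
          exact absurd hr (hN p hp)
        · obtain ⟨⟨p, l⟩, hpl⟩ := mem_iUnion.1 hxG
          obtain ⟨Y, hY⟩ := id hpl
          obtain ⟨p', hp', hr, hd⟩ := hx.reach p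
          obtain ⟨n, rfl⟩ := Nat.exists_eq_add_of_le hp'
          refine mem_iUnion.2 ⟨((p, l), (n, (st Y (l, 0) n).2)), ?_, hpl, hr⟩
          exact (key x p l n _ Y hY).2 ⟨rfl, tl_mem.2 hd⟩
    · rintro x (hx | hx)
      · exact hGV hx
      · obtain ⟨⟨⟨p, l⟩, ⟨n, q⟩⟩, h1, ⟨Y, hY⟩, hr⟩ := mem_iUnion.1 hx
        have := ((key x p l n q Y hY).1 h1).2
        rw [mem_omegaPower]
        exact Reach.dec hr (tl_mem.1 this)
  rw [hmain]
  refine hG.union hξ1 (.iUnion_countable hξ1 fun p => (ht _ _ _).preimage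
    (continuous_tl _) |>.inter_isClosed hξ1 ((isClosed_KK _ _).inter (hreach _).1))

theorem main_ge_three (ξ : Ordinal.{0}) (hξ : 2 < ξ) (hc : ξ.card ≤ Cardinal.aleph0) :
    ∃ A : Set (List Bool), SigmaO ξ (omegaPower A) ∧ Hard ξ (omegaPower A) := by
  have h12 : (1 : Ordinal.{0}) < 2 := by norm_num
  obtain ⟨B, hB, hH⟩ := exists_complete ξ (h12.trans hξ).le hc
  obtain ⟨U, hU, h0, hP⟩ := (rep_of_sigma hB).1
  refine ⟨lang (QQ U), sigma_omegaPower hξ hU hP, ?_⟩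
  intro Y _ _ _ E hE
  obtain ⟨f, hf, rfl⟩ := hH Y E hE
  refine ⟨fun y => out (f y) (0, 0), (continuous_out (0, 0)).comp hf, ?_⟩
  ext y
  rw [mem_preimage, mem_preimage, out_mem_iff hU (valid_zero _ _), h0]

/-! ### The cases `ξ = 1` and `ξ = 2` -/

/-- The prefix of length `n` of `x` is safe: removing it preserves `N`. -/
def CC {α : Type*} (N : Set (ℕ → α)) (x : ℕ → α) (n : ℕ) : Prop :=
  0 < n ∧ ∀ z, (∀ i < n, z i = x i) → z ∈ N → tl n z ∈ N

theorem pre_mem_CC {α : Type*} {N : Set (ℕ → α)} {x : ℕ → α} {n : ℕ} :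
    pre x n ∈ lang (CC N) ↔ CC N x n := by
  rw [pre_mem_lang]
  constructor
  · rintro ⟨w, hw, h0, h⟩
    exact ⟨h0, fun z hz => h z fun i hi => (hz i hi).trans (hw i hi)⟩
  · intro h
    exact ⟨x, fun _ _ => rfl, h⟩

theorem blk_CC {α : Type*} {N : Set (ℕ → α)} {x : ℕ → α} {a b : ℕ} :
    Blk (lang (CC N)) x a b ↔ a < b ∧ CC N (tl a x) (b - a) := by
  unfold Blk
  rw [pre_mem_CC]

theorem dec_of_not_mem {α : Type*} {N : Set (ℕ → α)}
    (ha : ∀ x, x ∉ N → ∃ n, CC N x n ∧ tl n x ∉ N) {x : ℕ → α} (hx : x ∉ N) :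
    Dec (lang (CC N)) x 0 := by
  have step : ∀ p : {p : ℕ // tl p x ∉ N}, ∃ q : {p : ℕ // tl p x ∉ N},
      Blk (lang (CC N)) x p.1 q.1 := by
    rintro ⟨p, hp⟩
    obtain ⟨n, hn, hn2⟩ := ha _ hp
    rw [tl_tl] at hn2
    refine ⟨⟨p + n, hn2⟩, ?_⟩
    rw [blk_CC]
    have := hn.1
    simp only [Nat.add_sub_cancel_left]
    exact ⟨by omega, hn⟩
  choose nx hnx using step
  have h0 : tl 0 x ∉ N := by
    have : tl 0 x = x := by funext i; simp [tl]
    rwa [this]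
  refine ⟨fun k => (nx^[k] ⟨0, h0⟩).1, rfl, fun k => ?_⟩
  simp only [Function.iterate_succ_apply']
  exact hnx _

theorem cut_mem {α : Type*} {N : Set (ℕ → α)} {x : ℕ → α} (hx : x ∈ N) {f : ℕ → ℕ}
    (h0 : f 0 = 0) (hf : ∀ k, Blk (lang (CC N)) x (f k) (f (k + 1))) (k : ℕ) :
    tl (f k) x ∈ N := by
  induction k with
  | zero =>
    have : tl 0 x = x := by funext i; simp [tl]
    rwa [h0, this]
  | succ k ih =>
    obtain ⟨h1, h2⟩ := blk_CC.1 (hf k)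
    have := h2.2 _ (fun _ _ => rfl) ih
    rwa [tl_tl, Nat.add_sub_cancel' h1.le] at this

theorem omegaPower_CC {α : Type*} {N : Set (ℕ → α)}
    (ha : ∀ x, x ∉ N → ∃ n, CC N x n ∧ tl n x ∉ N)
    (hb : ∀ x, x ∈ N → ¬ Dec (lang (CC N)) x 0) : omegaPower (lang (CC N)) = Nᶜ := by
  ext x
  rw [mem_omegaPower, mem_compl_iff]
  exact ⟨fun h hx => hb x hx h, dec_of_not_mem ha⟩

/-- The set for `ξ = 1`. -/
def N1 : Set (ℕ → Bool) := {x | ∀ i, x i = decide (i = 0)}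

theorem main_one : ∃ A : Set (List Bool), SigmaO 1 (omegaPower A) ∧ Hard 1 (omegaPower A) := by
  classical
  have hno : ∀ x ∈ N1, ∀ n, 0 < n → tl n x ∉ N1 := by
    intro x hx n hn h
    have h1 := h 0
    have h2 := hx n
    simp only [tl, add_zero] at h1
    rw [h1] at h2
    have : n ≠ 0 := by omega
    simp [this] at h2
  have hA : omegaPower (lang (CC N1)) = N1ᶜ := by
    refine omegaPower_CC (fun x hx => ?_) (fun x hx hd => ?_)
    · have hx' := hx
      simp only [N1, mem_ofPred_eq, not_forall] at hx
      obtain ⟨i, hi⟩ := hx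
      have hC : ∀ n, i < n → CC N1 x n := fun n hn =>
        ⟨by omega, fun z hz hzN => absurd ((hz i hn).symm.trans (hzN i)) hi⟩
      by_cases h : tl (i + 1) x ∈ N1
      · refine ⟨i + 2, hC _ (by omega), ?_⟩
        have := hno _ h 1 one_pos
        rwa [tl_tl] at this
      · exact ⟨i + 1, hC _ (by omega), h⟩
    · obtain ⟨f, h0, hf⟩ := hd
      have h1 := cut_mem hx h0 hf 1
      have h2 := (hf 0).1
      exact hno x hx (f 1) (by simp only [zero_add] at h2; omega) h1
  refine ⟨lang (CC N1), ?_, ?_⟩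
  rotate_left
  · rw [hA]
    intro Y _ _ _ E hE
    have hO := hE.one
    refine ⟨fun y n => if n = 0 then true else decide (y ∈ appr E n), ?_, ?_⟩
    · refine continuous_pi fun n => continuous_of_dep ⟨n, fun x z h => ?_⟩
      have : x ∈ appr E n ↔ z ∈ appr E n :=
        ⟨appr_dep x z h, appr_dep z x fun i hi => (h i hi).symm⟩
      simp only [this]
    · ext y
      rw [mem_preimage, mem_compl_iff]
      constructor
      · intro hy hN
        rw [← iUnion_appr hO, mem_iUnion] at hy
        obtain ⟨n, hn⟩ := hy
        have h1 := hN (n + 1)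
        have := appr_mono (Nat.le_succ n) hn
        simp [this] at h1
      · intro hy
        by_contra hE'
        refine hy fun n => ?_
        by_cases h : n = 0
        · simp [h]
        · simp only [h, if_false, decide_false, decide_eq_false_iff_not]
          exact fun h' => hE' (h' y fun _ _ => rfl)
  · rw [hA]
    refine .isOpen _ ?_
    have : N1 = ⋂ i, {x | x i = decide (i = 0)} := by
      ext x
      simp [N1]
    rw [this, isOpen_compl_iff]
    exact isClosed_iInter fun i => isClosed_eq (continuous_apply i) continuous_const

/-! ### Changing the alphabet -/

section Alphabet

variable {α : Type*} (e : Bool × Bool ≃ α)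

/-- Decoding pairs of bits. -/
def dcd (x : ℕ → Bool) : ℕ → α := fun i => e (x (2 * i), x (2 * i + 1))

/-- The language of codes. -/
def langB (A : Set (List α)) : Set (List Bool) :=
  lang fun z n => ∃ m, n = 2 * m ∧ pre (dcd e z) m ∈ A

theorem blk_langB {A : Set (List α)} {x : ℕ → Bool} {a b : ℕ} :
    Blk (langB e A) x (2 * a) b ↔ ∃ c, b = 2 * c ∧ Blk A (dcd e x) a c := by
  have key : dcd e (tl (2 * a) x) = tl a (dcd e x) := by
    funext i
    simp only [dcd, tl, mul_add, add_assoc]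
  unfold Blk langB
  rw [pre_mem_lang]
  constructor
  · rintro ⟨h, z, hz, m, hm, hA⟩
    refine ⟨a + m, by omega, by omega, ?_⟩
    rw [Nat.add_sub_cancel_left, ← key]
    convert hA using 1
    rw [pre_inj]
    refine ⟨rfl, fun i hi => ?_⟩
    unfold dcd
    rw [hz _ (by omega), hz _ (by omega)]
  · rintro ⟨c, rfl, h, hA⟩
    refine ⟨by omega, _, fun _ _ => rfl, c - a, by omega, ?_⟩
    rwa [key]

theorem omegaPower_langB (A : Set (List α)) :
    omegaPower (langB e A) = dcd e ⁻¹' omegaPower A := by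
  ext x
  rw [mem_preimage, mem_omegaPower, mem_omegaPower]
  constructor
  · rintro ⟨f, h0, hf⟩
    have hev : ∀ k, f k = 2 * (f k / 2) := by
      intro k
      induction k with
      | zero => simp [h0]
      | succ k ih =>
        have h1 := hf k
        rw [ih, blk_langB] at h1
        obtain ⟨c, hc, -⟩ := h1
        omega
    refine ⟨fun k => f k / 2, by simp [h0], fun k => ?_⟩
    have h1 := hf k
    rw [hev k, blk_langB] at h1
    obtain ⟨c, hc, h⟩ := h1
    have : f (k + 1) / 2 = c := by omega
    simp only [this]
    exact h
  · rintro ⟨f, h0, hf⟩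
    exact ⟨fun k => 2 * f k, by simp [h0], fun k => (blk_langB e).2 ⟨_, rfl, hf k⟩⟩

theorem continuous_dcd [TopologicalSpace α] : Continuous (dcd e) :=
  continuous_pi fun n => continuous_of_dep ⟨2 * n + 2, fun x z h => by
    unfold dcd
    rw [h _ (by omega), h _ (by omega)]⟩

/-- Encoding by pairs of bits. -/
def ecd (x : ℕ → α) : ℕ → Bool := fun i =>
  if i % 2 = 0 then (e.symm (x (i / 2))).1 else (e.symm (x (i / 2))).2

theorem dcd_ecd (x : ℕ → α) : dcd e (ecd e x) = x := by
  funext i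
  unfold dcd ecd
  have h1 : 2 * i / 2 = i := by omega
  have h2 : (2 * i + 1) / 2 = i := by omega
  have h3 : (2 * i + 1) % 2 = 1 := by omega
  simp [h2, h3]

theorem continuous_ecd [TopologicalSpace α] [DiscreteTopology α] : Continuous (ecd e) :=
  continuous_pi fun n => continuous_of_dep ⟨n / 2 + 1, fun x z h => by
    unfold ecd
    rw [h _ (by omega)]⟩

end Alphabet

/-! ### The set for `ξ = 2` -/

/-- Well formed words. -/
def WF (y : ℕ → Fin 4) : Prop := y 0 ≠ 3 ∧ ∀ i, y i ≠ 1 ∧ (y (i + 1) = 3 ↔ y i = 2)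

/-- Infinitely many letters `2`. -/
def Inf2 (y : ℕ → Fin 4) : Prop := ∀ n, ∃ m, n ≤ m ∧ y m = 2

/-- First kind of words. -/
def NA (x : ℕ → Fin 4) : Prop :=
  ∃ k, (∀ i < k, x i = 0) ∧ x k = 1 ∧ WF (tl (k + 1) x) ∧ Inf2 x

/-- Second kind of words. -/
def NB (x : ℕ → Fin 4) : Prop :=
  ∃ k, (∀ i < k, x i = 0) ∧ x k = 2 ∧ x (k + 1) = 3

/-- The set for `ξ = 2`. -/
def N2 : Set (ℕ → Fin 4) := {x | NA x ∨ NB x}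

theorem four (l : Fin 4) : l = 0 ∨ l = 1 ∨ l = 2 ∨ l = 3 := by
  revert l; decide

theorem N2_ne_three {x} (h : x ∈ N2) : x 0 ≠ 3 := by
  rcases h with ⟨k, h0, h1, -⟩ | ⟨k, h0, h1, -⟩ <;> rcases k with _ | k
  · simp [h1]
  · simp [h0 0 (by omega)]
  · simp [h1]
  · simp [h0 0 (by omega)]

theorem NA_of_one {x} (h : x ∈ N2) (h1 : x 0 = 1) : WF (tl 1 x) ∧ Inf2 x := by
  rcases h with ⟨k, h0, h1', h⟩ | ⟨k, h0, h1', -⟩ <;> rcases k with _ | k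
  · exact h
  · have := h0 0 (by omega); rw [h1] at this; exact absurd this (by decide)
  · rw [h1] at h1'; exact absurd h1' (by decide)
  · have := h0 0 (by omega); rw [h1] at this; exact absurd this (by decide)

theorem N2_two {x} (h : x ∈ N2) (h1 : x 0 = 2) : x 1 = 3 := by
  rcases h with ⟨k, h0, h1', h⟩ | ⟨k, h0, h1', h⟩ <;> rcases k with _ | k
  · rw [h1] at h1'; exact absurd h1' (by decide)
  · have := h0 0 (by omega); rw [h1] at this; exact absurd this (by decide)
  · exact h
  · have := h0 0 (by omega); rw [h1] at this; exact absurd this (by decide)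

theorem Inf2_tl {x : ℕ → Fin 4} {a} : Inf2 (tl a x) ↔ Inf2 x := by
  constructor
  · intro h n
    obtain ⟨m, hm, h2⟩ := h n
    exact ⟨a + m, by omega, h2⟩
  · intro h n
    obtain ⟨m, hm, h2⟩ := h (a + n)
    refine ⟨m - a, by omega, ?_⟩
    unfold tl
    rwa [Nat.add_sub_cancel' (by omega)]

theorem N2_zero {x} (h1 : x 0 = 0) : x ∈ N2 ↔ tl 1 x ∈ N2 := by
  constructor
  · rintro (⟨k, h0, h1', h2, h3⟩ | ⟨k, h0, h1', h⟩) <;> rcases k with _ | k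
    · rw [h1] at h1'; exact absurd h1' (by decide)
    · refine Or.inl ⟨k, fun i hi => h0 _ (by omega), ?_, ?_, Inf2_tl.2 h3⟩
      · rwa [tl, add_comm]
      · rwa [tl_tl, add_comm]
    · rw [h1] at h1'; exact absurd h1' (by decide)
    · refine Or.inr ⟨k, fun i hi => h0 _ (by omega), ?_, ?_⟩
      · rwa [tl, add_comm]
      · rwa [tl, add_comm]
  · have hz : ∀ k, (∀ i < k, tl 1 x i = 0) → ∀ i < k + 1, x i = 0 := by
      intro k hk i hi
      rcases i with _ | i
      · exact h1
      · rw [add_comm]; exact hk i (by omega)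
    rintro (⟨k, h0, h1', h2, h3⟩ | ⟨k, h0, h1', h⟩)
    · refine Or.inl ⟨k + 1, hz k h0, ?_, ?_, Inf2_tl.1 h3⟩
      · rwa [tl, add_comm] at h1'
      · rwa [tl_tl, add_comm] at h2
    · refine Or.inr ⟨k + 1, hz k h0, ?_, ?_⟩
      · rwa [tl, add_comm] at h1'
      · rwa [tl, add_comm] at h

theorem N2_tail (x : ℕ → Fin 4) (m : ℕ) : ∃ n, m ≤ n ∧ tl n x ∉ N2 := by
  by_contra! hcon
  have h3 : ∀ n, m ≤ n → x n ≠ 3 := fun n hn => N2_ne_three (hcon n hn)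
  rcases hcon m le_rfl with ⟨k, h0, h1, h2, hi⟩ | ⟨k, h0, h1, h⟩
  · obtain ⟨j, hj, hj2⟩ := hi (k + 1)
    have := (h2.2 (j - (k + 1))).2
    rw [tl_tl] at this
    simp only [tl] at this hj2
    have e1 : m + (k + 1) + (j - (k + 1)) = m + j := by omega
    have e2 : m + (k + 1) + (j - (k + 1) + 1) = m + j + 1 := by omega
    rw [e1, e2] at this
    exact h3 _ (by omega) (this.2 hj2)
  · exact h3 _ (by omega) h

theorem N2_cut {x : ℕ → Fin 4} (hx : x ∉ N2) : ∃ n, CC N2 x n ∧ tl n x ∉ N2 := by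
  have vac : (∃ n₀, ∀ z, (∀ i < n₀, z i = x i) → z ∉ N2) → ∃ n, CC N2 x n ∧ tl n x ∉ N2 := by
    rintro ⟨n₀, h⟩
    obtain ⟨n, hn, hn2⟩ := N2_tail x (n₀ + 1)
    exact ⟨n, ⟨by omega, fun z hz hzN => absurd hzN (h z fun i hi => hz i (by omega))⟩, hn2⟩
  rcases four (x 0) with h | h | h | h
  · refine ⟨1, ⟨one_pos, fun z hz hzN => (N2_zero ?_).1 hzN⟩, fun h' => hx ((N2_zero h).2 h')⟩
    rw [hz 0 one_pos, h]
  · by_cases hW : WF (tl 1 x)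
    · have hI : ¬ Inf2 x := fun hI => hx (Or.inl ⟨0, by simp, h, hW, hI⟩)
      have hI' := hI
      unfold Inf2 at hI
      push Not at hI
      obtain ⟨n, hn⟩ := hI
      refine ⟨n + 2, ⟨by omega, fun z hz hzN => ?_⟩, ?_⟩
      · obtain ⟨h1, h2⟩ := NA_of_one hzN ((hz 0 (by omega)).trans h)
        have hWz : ∀ i, z (i + 1) ≠ 1 ∧ (z (i + 2) = 3 ↔ z (i + 1) = 2) := by
          intro i
          have := h1.2 i
          simp only [tl] at this
          rwa [add_comm 1 i, show 1 + (i + 1) = i + 2 by omega] at this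
        have hex : ∃ j, z (n + 2 + j) = 2 := by
          obtain ⟨j, hj, hj2⟩ := h2 (n + 2)
          exact ⟨j - (n + 2), by rwa [Nat.add_sub_cancel' hj]⟩
        have hprev : z (n + 1) ≠ 2 := by
          rw [hz _ (by omega)]; exact hn _ (by omega)
        refine Or.inr ⟨Nat.find hex, fun i hi => ?_, Nat.find_spec hex, ?_⟩
        · have hne : z (n + 2 + i) ≠ 3 := by
            intro h3
            rcases i with _ | i
            · exact hprev ((hWz n).2.1 h3)
            · have h4 := (hWz (n + 1 + i)).2.1 (by rw [← h3]; congr 1; omega)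
              rw [show n + 1 + i + 1 = n + 2 + i by omega] at h4
              exact Nat.find_min hex (by omega) h4
          have h1' := (hWz (n + 1 + i)).1
          rw [show n + 1 + i + 1 = n + 2 + i by omega] at h1'
          have h2' := Nat.find_min hex hi
          rcases four (z (n + 2 + i)) with h | h | h | h
          · exact h
          · exact absurd h h1'
          · exact absurd h h2'
          · exact absurd h hne
        · have h3 := (hWz (n + 1 + Nat.find hex)).2.2 (by
            rw [show n + 1 + Nat.find hex + 1 = n + 2 + Nat.find hex by omega]
            exact Nat.find_spec hex)
          rw [← h3]
          unfold tl
          congr 1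
          omega
      · rintro (⟨k, h0, h1, h2, h3⟩ | ⟨k, h0, h1, h2⟩)
        · exact hI' (Inf2_tl.1 h3)
        · exact hn _ (by omega) h1
    · apply vac
      have hN : ∀ z, z 0 = x 0 → z ∈ N2 → WF (tl 1 z) := fun z hz hzN =>
        (NA_of_one hzN (hz.trans h)).1
      unfold WF at hW
      rw [Classical.not_and_iff_not_or_not] at hW
      rcases hW with hW | hW
      · refine ⟨2, fun z hz hzN => hW ?_⟩
        have := (hN z (hz 0 (by omega)) hzN).1
        unfold tl at *
        rwa [← hz _ (by omega)]
      · obtain ⟨i, hW⟩ := Classical.not_forall.1 hW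
        refine ⟨i + 3, fun z hz hzN => hW ?_⟩
        have := (hN z (hz 0 (by omega)) hzN).2 i
        unfold tl at *
        rwa [← hz _ (by omega), ← hz _ (by omega)]
  · refine vac ⟨2, fun z hz hzN => hx ?_⟩
    have := N2_two hzN ((hz 0 (by omega)).trans h)
    exact Or.inr ⟨0, by simp, h, by rw [← hz _ (by omega)]; exact this⟩
  · refine vac ⟨1, fun z hz hzN => N2_ne_three hzN ?_⟩
    rw [hz 0 one_pos, h]

theorem NB_not_dec {y : ℕ → Fin 4} (hy : NB y) : ¬ Dec (lang (CC N2)) y 0 := by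
  classical
  rintro ⟨f, hf0, hf⟩
  obtain ⟨k, h0, h1, h2⟩ := hy
  have hmono : StrictMono f := strictMono_nat_of_lt_succ fun k => (hf k).1
  have hex : ∃ j, k < f (j + 1) := ⟨k, (hmono.id_le (k + 1))⟩
  have hj := Nat.find_spec hex
  have hj' : f (Nat.find hex) ≤ k := by
    rcases h : Nat.find hex with _ | j
    · omega
    · exact not_lt.1 (Nat.find_min hex (m := j) (by omega))
  generalize Nat.find hex = j at hj hj'
  obtain ⟨hlt, -, hC⟩ := blk_CC.1 (hf j)
  have := hC (fun i => if i < f (j + 1) - f j then y (f j + i) else 3)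
    (fun i hi => by simp only [hi, if_true]; rfl)
    (Or.inr ⟨k - f j, fun i hi => ?_, ?_, ?_⟩)
  · exact N2_ne_three this (by simp [tl])
  · simp only; rw [if_pos (by omega)]; exact h0 _ (by omega)
  · simp only; rw [if_pos (by omega), Nat.add_sub_cancel' hj', h1]
  · simp only; split_ifs
    · rw [← h2]; congr 1; omega
    · rfl

theorem N2_not_dec {y : ℕ → Fin 4} (hy : y ∈ N2) : ¬ Dec (lang (CC N2)) y 0 := by
  rcases id hy with ⟨k, h0, h1, hW, hI⟩ | hy'
  · rintro ⟨f, hf0, hf⟩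
    have hmono : StrictMono f := strictMono_nat_of_lt_succ fun k => (hf k).1
    have hk : k + 1 ≤ f (k + 1) := hmono.id_le _
    rcases cut_mem hy hf0 hf (k + 1) with ⟨l, -, h3, -⟩ | h
    · refine (hW.2 (f (k + 1) + l - (k + 1))).1 ?_
      unfold tl at *
      rw [← h3]
      congr 1
      omega
    · refine NB_not_dec h ?_
      rw [Dec_tl]
      exact ⟨fun i => f (k + 1 + i), rfl, fun i => hf _⟩
  · exact NB_not_dec hy'

theorem NA_iff {x : ℕ → Fin 4} : NA x ↔ Inf2 x ∧
    ∀ k, (∀ i < k, x i = 0) → x k = 0 ∨ (x k = 1 ∧ WF (tl (k + 1) x)) := by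
  constructor
  · rintro ⟨k, h0, h1, h2, h3⟩
    refine ⟨h3, fun l hl => ?_⟩
    rcases lt_trichotomy l k with h | rfl | h
    · exact Or.inl (h0 l h)
    · exact Or.inr ⟨h1, h2⟩
    · have := hl k h; rw [h1] at this; exact absurd this (by decide)
  · rintro ⟨h1, h2⟩
    by_contra hcon
    have : ∀ k, x k = 0 := by
      intro k
      induction k using Nat.strong_induction_on with
      | _ k ih =>
        rcases h2 k ih with h | ⟨h, h'⟩
        · exact h
        · exact absurd ⟨k, ih, h, h', h1⟩ hcon
    obtain ⟨m, -, hm⟩ := h1 0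
    rw [this] at hm
    exact absurd hm (by decide)

theorem sigma_N2 : SigmaO 2 N2ᶜ := by
  have h12 : (1 : Ordinal.{0}) < 2 := by norm_num
  have e : N2ᶜ = ({x | Inf2 x}ᶜ ∪
      {x | ∀ k, (∀ i < k, x i = 0) → x k = 0 ∨ (x k = 1 ∧ WF (tl (k + 1) x))}ᶜ) ∩
      {x | NB x}ᶜ := by
    rw [← compl_inter, ← compl_union]
    congr 1
    ext x
    exact or_congr_left NA_iff
  have hev : ∀ (n : ℕ) (l : Fin 4), IsClopen {x : ℕ → Fin 4 | x n = l} := fun n l =>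
    isClopen_of_dep (n + 1) fun x z h hx => (h n (by omega)).symm.trans hx
  rw [e]
  refine SigmaO.inter_isClosed h12 (SigmaO.union_isOpen ?_ ?_) ?_
  · have : {x | Inf2 x}ᶜ = ⋃ n, ⋂ m, ⋂ (_ : n ≤ m), {x : ℕ → Fin 4 | x m = 2}ᶜ := by
      ext x
      simp only [mem_compl_iff, mem_ofPred_eq, mem_iUnion, mem_iInter, Inf2]
      push Not
      rfl
    rw [this]
    exact .iUnion' h12 fun n => .of_isClosed (isClosed_iInter fun m => isClosed_iInter fun _ =>
      (hev m 2).compl.1) h12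
  · have : {x : ℕ → Fin 4 | ∀ k, (∀ i < k, x i = 0) →
        x k = 0 ∨ (x k = 1 ∧ WF (tl (k + 1) x))} = ⋂ k, ⋂ j,
        {x | (∀ i < k, x i = 0) → x k = 0 ∨ (x k = 1 ∧ tl (k + 1) x 0 ≠ 3 ∧
          (tl (k + 1) x j ≠ 1 ∧ (tl (k + 1) x (j + 1) = 3 ↔ tl (k + 1) x j = 2)))} := by
      ext x
      simp only [mem_ofPred_eq, mem_iInter, WF]
      constructor
      · intro h k j hk
        rcases h k hk with h | h
        · exact Or.inl h
        · exact Or.inr ⟨h.1, h.2.1, h.2.2 j⟩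
      · intro h k hk
        by_cases h0 : x k = 0
        · exact Or.inl h0
        · have := fun j => (h k j hk).resolve_left h0
          exact Or.inr ⟨(this 0).1, (this 0).2.1, fun j => (this j).2.2⟩
    rw [this, isOpen_compl_iff]
    refine isClosed_iInter fun k => isClosed_iInter fun j =>
      (isClopen_of_dep (k + j + 3) fun x z h hx => ?_).1
    simp only [mem_ofPred_eq, tl] at hx ⊢
    rw [← h k (by omega), ← h (k + 1 + 0) (by omega), ← h (k + 1 + j) (by omega),
      ← h (k + 1 + (j + 1)) (by omega)]
    intro hk
    exact hx fun i hi => (h i (by omega)).trans (hk i hi)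
  · have : {x | NB x} = ⋃ k, {x | (∀ i < k, x i = 0) ∧ x k = 2 ∧ x (k + 1) = 3} := by
      ext x
      simp [NB]
    rw [this, isClosed_compl_iff]
    refine isOpen_iUnion fun k => isOpen_of_dep (k + 2) fun x z h hx => ?_
    simp only [mem_ofPred_eq] at hx ⊢
    rw [← h k (by omega), ← h (k + 1) (by omega)]
    exact ⟨fun i hi => (h i (by omega)).symm.trans (hx.1 i hi), hx.2⟩

theorem hard_N2 (Y : Type) [Fintype Y] [TopologicalSpace Y] [DiscreteTopology Y]
    (E : Set (ℕ → Y)) (hE : SigmaO 2 E) :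
    ∃ f : (ℕ → Y) → (ℕ → Fin 4), Continuous f ∧ E = f ⁻¹' N2ᶜ := by
  classical
  have h12 : (1 : Ordinal.{0}) < 2 := by norm_num
  obtain ⟨F, g, hg, hF, rfl⟩ := hE.exists_iUnion h12
  have hF' : ∀ n, IsOpen (F n)ᶜ := by
    intro n
    have h1 : g n = 1 := by
      refine le_antisymm ?_ (hF n).pos
      have := hg n
      rw [← one_add_one_eq_two] at this
      exact Order.lt_add_one_iff.1 this
    have h2 := hF n
    rw [h1] at h2
    exact h2.one
  let O : ℕ → Set (ℕ → Y) := fun k => ⋂ j ∈ Set.Iic k, (F j)ᶜ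
  have hO : ∀ k, IsOpen (O k) := fun k =>
    (Set.finite_Iic k).isOpen_biInter fun j _ => hF' j
  have hOm : ∀ k y, y ∈ O k ↔ ∀ j ≤ k, y ∉ F j := fun k y => by simp [O]
  let ev : (ℕ → Y) → ℕ → Prop := fun y t =>
    y ∈ appr (O t.unpair.1) t.unpair.2 ∧ ∀ m < t.unpair.2, y ∉ appr (O t.unpair.1) m
  let L : (ℕ → Y) → ℕ → Fin 4 := fun y n => if n = 0 then 1 else
    if ev y ((n - 1) / 2) then (if (n - 1) % 2 = 0 then 2 else 3) else 0
  have hWF : ∀ y, WF (tl 1 (L y)) := by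
    intro y
    have hL : ∀ i, tl 1 (L y) i = if ev y (i / 2) then (if i % 2 = 0 then 2 else 3) else 0 := by
      intro i
      simp [tl, L]
    refine ⟨?_, fun i => ⟨?_, ?_⟩⟩
    · rw [hL]
      split_ifs <;> simp_all
    · rw [hL]
      split_ifs <;> decide
    · rw [hL, hL]
      rcases Nat.mod_two_eq_zero_or_one i with h | h
      · have h1 : (i + 1) / 2 = i / 2 := by omega
        have h2 : (i + 1) % 2 = 1 := by omega
        rw [h1, h2, h]
        split_ifs <;> simp_all
      · have h2 : (i + 1) % 2 = 0 := by omega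
        rw [h2, h]
        split_ifs <;> simp_all
  have hinf : ∀ y, L y ∈ N2 ↔ {t | ev y t}.Infinite := by
    intro y
    have h1 : L y ∈ N2 ↔ Inf2 (L y) := by
      constructor
      · intro h
        exact (NA_of_one h (by simp [L])).2
      · intro h
        exact Or.inl ⟨0, by simp, by simp [L], hWF y, h⟩
    rw [h1]
    constructor
    · intro h
      refine Set.infinite_of_forall_exists_gt fun n => ?_
      obtain ⟨m, hm, h2⟩ := h (2 * n + 5)
      refine ⟨(m - 1) / 2, ?_, by omega⟩
      simp only [L] at h2
      by_contra hc
      have hc' : ¬ ev y ((m - 1) / 2) := hc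
      rw [if_neg (by omega), if_neg hc'] at h2
      exact absurd h2 (by decide)
    · intro h n
      obtain ⟨t, ht, hn⟩ := h.exists_gt n
      refine ⟨2 * t + 1, by omega, ?_⟩
      have : ev y t := ht
      simp [L, this]
  refine ⟨L, ?_, ?_⟩
  · refine continuous_pi fun n => continuous_of_dep
      ⟨(Nat.unpair ((n - 1) / 2)).2, fun x z h => ?_⟩
    have key : ∀ O : Set (ℕ → Y), ∀ m ≤ (Nat.unpair ((n - 1) / 2)).2,
        (x ∈ appr O m ↔ z ∈ appr O m) := fun O m hm =>
      ⟨appr_dep x z fun i hi => h i (by omega),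
        appr_dep z x fun i hi => (h i (by omega)).symm⟩
    have : ev x ((n - 1) / 2) ↔ ev z ((n - 1) / 2) := by
      refine and_congr (key _ _ le_rfl) (forall_congr' fun m => forall_congr' fun hm => ?_)
      exact not_congr (key _ _ hm.le)
    simp only [L, this]
  · ext y
    rw [mem_preimage, mem_compl_iff, hinf, Set.not_infinite]
    constructor
    · intro hy
      obtain ⟨j, hj⟩ := mem_iUnion.1 hy
      refine Set.Finite.subset (Set.Finite.biUnion (Set.finite_Iio j)
        (t := fun k => {t | ev y t ∧ t.unpair.1 = k}) fun k _ =>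
          Set.Subsingleton.finite ?_) ?_
      · rintro t ⟨ht, ht1⟩ s ⟨hs, hs1⟩
        have h2 : t.unpair.2 = s.unpair.2 := by
          rcases lt_trichotomy t.unpair.2 s.unpair.2 with h | h | h
          · have h3 := hs.2 _ h
            rw [hs1, ← ht1] at h3
            exact absurd ht.1 h3
          · exact h
          · have h3 := ht.2 _ h
            rw [ht1, ← hs1] at h3
            exact absurd hs.1 h3
        rw [← Nat.pair_unpair t, ← Nat.pair_unpair s, h2, ht1, hs1]
      · intro t ht
        refine mem_biUnion (x := t.unpair.1) ?_ ⟨ht, rfl⟩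
        by_contra hc
        have h1 : y ∈ O t.unpair.1 := ht.1 y fun _ _ => rfl
        exact (hOm _ _).1 h1 j (by simpa using hc) hj
    · intro hfin
      by_contra hy
      rw [mem_iUnion, not_exists] at hy
      have : ∀ k, ∃ m, ev y (Nat.pair k m) := by
        intro k
        have h1 : y ∈ O k := (hOm _ _).2 fun j _ => hy j
        rw [← iUnion_appr (hO k), mem_iUnion] at h1
        refine ⟨Nat.find h1, ?_⟩
        simp only [ev, Nat.unpair_pair]
        exact ⟨Nat.find_spec h1, fun m hm => Nat.find_min h1 hm⟩
      choose m hm using this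
      refine Set.infinite_of_injective_forall_mem (f := fun k => Nat.pair k (m k)) ?_
        (fun k => hm k) hfin
      intro a b hab
      exact (Nat.pair_eq_pair.1 hab).1

theorem main_two : ∃ A : Set (List Bool), SigmaO 2 (omegaPower A) ∧ Hard 2 (omegaPower A) := by
  have e : Bool × Bool ≃ Fin 4 := Fintype.equivOfCardEq (by decide)
  refine ⟨langB e (lang (CC N2)), ?_⟩
  rw [omegaPower_langB, omegaPower_CC (fun _ => N2_cut) (fun _ => N2_not_dec)]
  refine ⟨sigma_N2.preimage (continuous_dcd e), ?_⟩
  intro Y _ _ _ E hE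
  obtain ⟨f, hf, rfl⟩ := hard_N2 Y E hE
  refine ⟨fun y => ecd e (f y), (continuous_ecd e).comp hf, ?_⟩
  ext y
  simp only [mem_preimage, dcd_ecd]


/-- For each non-null countable ordinal `ξ` there is a language `A ⊆ 2^{<ω}` whose ω-power
is a `Σ⁰_ξ`-complete subset of Cantor space: `A^ω ∈ Σ⁰_ξ(2^ω)` and every `Σ⁰_ξ` subset of
`Y^ω`, for a finite alphabet `Y`, is the preimage of `A^ω` under some continuous map. -/
theorem exists_sigma_complete_omegaPower (ξ : Ordinal.{0}) (hξ : ξ ≠ 0)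
    (hcount : ξ.card ≤ Cardinal.aleph0) :
    ∃ A : Set (List Bool),
      SigmaO ξ (omegaPower A) ∧
      ∀ (Y : Type) [Fintype Y] [TopologicalSpace Y] [DiscreteTopology Y]
        (E : Set (ℕ → Y)), SigmaO ξ E →
          ∃ f : (ℕ → Y) → (ℕ → Bool), Continuous f ∧ E = f ⁻¹' omegaPower A := by
  have h1 : 1 ≤ ξ := Ordinal.one_le_iff_ne_zero.2 hξ
  have key : ∃ A : Set (List Bool), SigmaO ξ (omegaPower A) ∧ Hard ξ (omegaPower A) := by
    rcases h1.eq_or_lt with rfl | h1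
    · exact main_one
    · have h2 : 2 ≤ ξ := by
        rw [← one_add_one_eq_two]
        exact Order.add_one_le_iff.2 h1
      rcases h2.eq_or_lt with rfl | h2
      · exact main_two
      · exact main_ge_three ξ h2 hcount
  obtain ⟨A, hA, hH⟩ := key
  exact ⟨A, hA, fun Y _ _ _ E hE => hH Y E hE⟩
end

section
/- There exists a context-free language A ⊆ 2^{<ω} of finite binary words such that the ω-power A^ω ⊆ 2^ω is an F_σ subset of Cantor space (a countable union of closed sets, i.e. Σ^0_2) but is not a G_δ subset (not a countable intersection of open sets, i.e. not Π^0_2). -/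
open Set

/-- A set is `F_σ` if it is a countable union of closed sets. -/
def FSigmaSet {X : Type*} [TopologicalSpace X] (s : Set X) : Prop :=
  ∃ F : ℕ → Set X, (∀ n, IsClosed (F n)) ∧ s = ⋃ n, F n

/-- A set is `G_δ` if it is a countable intersection of open sets. -/
def GDeltaSet {X : Type*} [TopologicalSpace X] (s : Set X) : Prop :=
  ∃ U : ℕ → Set X, (∀ n, IsOpen (U n)) ∧ s = ⋂ n, U n

/-- `{000,001}^* · (ε ∪ 1·2^* ∪ 01·2^*)`. -/
def inN : List Bool → Prop
  | [] => True
  | true :: _ => True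
  | false :: true :: _ => True
  | false :: false :: _ :: l => inN l
  | [false] => False
  | [false, false] => False

/-- The language `{000} ∪ 01·2^* ∪ 1·N`. -/
def inV : List Bool → Prop
  | true :: l => inN l
  | false :: true :: _ => True
  | [false, false, false] => True
  | _ => False

/-- The three languages of the nonterminals. -/
def ntL : Fin 3 → List Bool → Prop
  | 0 => inV
  | 1 => inN
  | 2 => fun _ => True

abbrev tT (b : Bool) : Symbol Bool (Fin 3) := Symbol.terminal b
abbrev nT (n : Fin 3) : Symbol Bool (Fin 3) := Symbol.nonterminal n

def vRules : List (ContextFreeRule Bool (Fin 3)) :=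
  [⟨0, [tT false, tT false, tT false]⟩, ⟨0, [tT false, tT true, nT 2]⟩, ⟨0, [tT true, nT 1]⟩,
   ⟨1, []⟩, ⟨1, [tT true, nT 2]⟩, ⟨1, [tT false, tT true, nT 2]⟩,
   ⟨1, [tT false, tT false, tT false, nT 1]⟩, ⟨1, [tT false, tT false, tT true, nT 1]⟩,
   ⟨2, []⟩, ⟨2, [tT false, nT 2]⟩, ⟨2, [tT true, nT 2]⟩]

def vG : ContextFreeGrammar Bool where
  NT := Fin 3
  initial := (0 : Fin 3)
  rules := vRules.toFinset

def sem : List (Symbol Bool (Fin 3)) → List Bool → Prop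
  | [], w => w = []
  | Symbol.terminal a :: s, w => ∃ w', w = a :: w' ∧ sem s w'
  | Symbol.nonterminal n :: s, w => ∃ u v, w = u ++ v ∧ ntL n u ∧ sem s v

lemma sem_rewrites {r : ContextFreeRule Bool (Fin 3)}
    (hr : ∀ s w, sem (r.output ++ s) w → sem (Symbol.nonterminal r.input :: s) w)
    {a b : List (Symbol Bool (Fin 3))} (h : r.Rewrites a b) : ∀ w, sem b w → sem a w := by
  induction h with
  | head s => exact hr s
  | cons x _ ih =>
    intro w hw
    cases x with
    | terminal t =>
      obtain ⟨w', h1, h2⟩ := hw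
      exact ⟨w', h1, ih _ h2⟩
    | nonterminal n =>
      obtain ⟨u, v, h1, h2, h3⟩ := hw
      exact ⟨u, v, h1, h2, ih _ h3⟩

lemma sem_rule (r : ContextFreeRule Bool (Fin 3)) (hr : r ∈ vRules) :
    ∀ s w, sem (r.output ++ s) w → sem (Symbol.nonterminal r.input :: s) w := by
  intro s w h
  simp only [vRules, List.mem_cons, List.not_mem_nil, or_false] at hr
  rcases hr with rfl | rfl | rfl | rfl | rfl | rfl | rfl | rfl | rfl | rfl | rfl
  · obtain ⟨_, rfl, _, rfl, _, rfl, h⟩ := h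
    exact ⟨[false, false, false], _, rfl, trivial, h⟩
  · obtain ⟨_, rfl, _, rfl, u, v, rfl, h1, h⟩ := h
    exact ⟨false :: true :: u, v, rfl, trivial, h⟩
  · obtain ⟨_, rfl, u, v, rfl, h1, h⟩ := h
    exact ⟨true :: u, v, rfl, h1, h⟩
  · exact ⟨[], w, rfl, trivial, h⟩
  · obtain ⟨_, rfl, u, v, rfl, h1, h⟩ := h
    exact ⟨true :: u, v, rfl, trivial, h⟩
  · obtain ⟨_, rfl, _, rfl, u, v, rfl, h1, h⟩ := h
    exact ⟨false :: true :: u, v, rfl, trivial, h⟩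
  · obtain ⟨_, rfl, _, rfl, _, rfl, u, v, rfl, h1, h⟩ := h
    exact ⟨false :: false :: false :: u, v, rfl, h1, h⟩
  · obtain ⟨_, rfl, _, rfl, _, rfl, u, v, rfl, h1, h⟩ := h
    exact ⟨false :: false :: true :: u, v, rfl, h1, h⟩
  · exact ⟨[], w, rfl, trivial, h⟩
  · obtain ⟨_, rfl, u, v, rfl, h1, h⟩ := h
    exact ⟨false :: u, v, rfl, trivial, h⟩
  · obtain ⟨_, rfl, u, v, rfl, h1, h⟩ := h
    exact ⟨true :: u, v, rfl, trivial, h⟩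

lemma sem_derives {a b : List (Symbol Bool (Fin 3))} (h : vG.Derives a b) :
    ∀ w, sem b w → sem a w := by
  induction h with
  | refl => exact fun _ h => h
  | tail _ h2 ih =>
    obtain ⟨r, hr, h2⟩ := h2
    exact fun w hw => ih w (sem_rewrites (sem_rule r (List.mem_toFinset.1 hr)) h2 w hw)

lemma sem_map (w : List Bool) : sem (w.map Symbol.terminal) w := by
  induction w with
  | nil => rfl
  | cons a w ih => exact ⟨w, rfl, ih⟩

lemma mem_vG {r : ContextFreeRule Bool (Fin 3)} (hr : r ∈ vRules) : r ∈ vG.rules :=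
  List.mem_toFinset.2 hr

lemma step (n : Fin 3) (p : List Bool) (m : Fin 3) (w : List Bool)
    (hr : (⟨n, p.map tT ++ [nT m]⟩ : ContextFreeRule Bool (Fin 3)) ∈ vRules)
    (h : vG.Derives [nT m] (w.map Symbol.terminal)) :
    vG.Derives [nT n] ((p ++ w).map Symbol.terminal) := by
  have h1 : vG.Produces [nT n] (p.map tT ++ [nT m]) :=
    ⟨_, mem_vG hr, ContextFreeRule.Rewrites.input_output⟩
  refine h1.trans_derives ?_
  rw [List.map_append]
  exact h.append_left _

lemma stepT (n : Fin 3) (p : List Bool)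
    (hr : (⟨n, p.map tT⟩ : ContextFreeRule Bool (Fin 3)) ∈ vRules) :
    vG.Derives [nT n] (p.map Symbol.terminal) := by
  have h1 : vG.Produces [nT n] (p.map tT) :=
    ⟨_, mem_vG hr, ContextFreeRule.Rewrites.input_output⟩
  exact h1.single

lemma derX (w : List Bool) : vG.Derives [nT 2] (w.map Symbol.terminal) := by
  induction w with
  | nil => exact stepT 2 [] (by decide)
  | cons a w ih => cases a
                   · exact step 2 [false] 2 w (by decide) ih
                   · exact step 2 [true] 2 w (by decide) ih

lemma derN (w : List Bool) (h : inN w) : vG.Derives [nT 1] (w.map Symbol.terminal) := by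
  induction w using inN.induct with
  | case1 => exact stepT 1 [] (by decide)
  | case2 w => exact step 1 [true] 2 w (by decide) (derX w)
  | case3 w => exact step 1 [false, true] 2 w (by decide) (derX w)
  | case4 b w ih =>
    cases b
    · exact step 1 [false, false, false] 1 w (by decide) (ih h)
    · exact step 1 [false, false, true] 1 w (by decide) (ih h)
  | case5 => exact h.elim
  | case6 => exact h.elim

lemma derV (w : List Bool) (h : inV w) : vG.Derives [nT 0] (w.map Symbol.terminal) := by
  match w, h with
  | true :: l, h => exact step 0 [true] 1 l (by decide) (derN l h)
  | false :: true :: w, _ => exact step 0 [false, true] 2 w (by decide) (derX w)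
  | [false, false, false], _ => exact stepT 0 [false, false, false] (by decide)

lemma vG_language : vG.language = {w | inV w} := by
  ext w
  constructor
  · intro h
    obtain ⟨u, v, rfl, h1, rfl⟩ := sem_derives h w (sem_map w)
    rw [List.append_nil]
    exact h1
  · exact derV w

/-! ### Sequences -/

def pref (x : ℕ → Bool) (n : ℕ) : List Bool := List.ofFn fun i : Fin n => x i.val

def shift (n : ℕ) (x : ℕ → Bool) : ℕ → Bool := fun i => x (n + i)

lemma pref_succ (x : ℕ → Bool) (n : ℕ) : pref x (n + 1) = x 0 :: pref (shift 1 x) n := by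
  simp [pref, shift, List.ofFn_succ, add_comm]

lemma pref_congr {x y : ℕ → Bool} {n : ℕ} (h : ∀ i < n, x i = y i) : pref x n = pref y n := by
  unfold pref
  congr 1
  ext i
  exact h i i.2

lemma shift_shift (m n : ℕ) (x : ℕ → Bool) : shift m (shift n x) = shift (n + m) x := by
  funext i; simp [shift, add_assoc]

abbrev TT : Set (ℕ → Bool) := omegaPower {w | inV w}

lemma TT_unfold {x : ℕ → Bool} (h : x ∈ TT) : ∃ n > 0, inV (pref x n) ∧ shift n x ∈ TT := by
  obtain ⟨f, h0, hf, h⟩ := h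
  refine ⟨f 1, ?_, ?_, fun k => f (k + 1) - f 1, by simp, ?_, ?_⟩
  · have := hf (show 0 < 1 by omega); omega
  · have := h 0
    simp only [zero_add, h0, mem_setOf_eq, Nat.sub_zero] at this
    exact this
  · intro a b hab
    have h1 := hf (show a + 1 < b + 1 by omega)
    have h2 := hf.monotone (show 1 ≤ a + 1 by omega)
    dsimp only
    omega
  · intro k
    have h2 := hf.monotone (show 1 ≤ k + 1 by omega)
    have h3 := hf.monotone (show k + 1 ≤ k + 2 by omega)
    have := h (k + 1)
    have e : f (k + 1 + 1) - f 1 - (f (k + 1) - f 1) = f (k + 1 + 1) - f (k + 1) := by omega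
    dsimp only
    rw [e]
    have e2 : ∀ i, shift (f 1) x (f (k + 1) - f 1 + i) = x (f (k + 1) + i) := by
      intro i; unfold shift; congr 1; omega
    simp only [e2]
    exact this

lemma TT_coind (P : Set (ℕ → Bool))
    (hP : ∀ x ∈ P, ∃ n > 0, inV (pref x n) ∧ shift n x ∈ P) : P ⊆ TT := by
  intro x hx
  choose! g hg0 hgV hgP using hP
  let F : ℕ → ℕ := fun k => Nat.rec 0 (fun _ m => m + g (shift m x)) k
  have hF : ∀ k, F (k + 1) = F k + g (shift (F k) x) := fun k => rfl
  have hmem : ∀ k, shift (F k) x ∈ P := by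
    intro k
    induction k with
    | zero =>
      have e : shift (F 0) x = x := by funext i; simp [F, shift]
      rwa [e]
    | succ k ih =>
      rw [hF, ← shift_shift]
      exact hgP _ ih
  refine ⟨F, rfl, strictMono_nat_of_lt_succ fun k => ?_, fun k => ?_⟩
  · rw [hF]; have := hg0 _ (hmem k); omega
  · have e : F (k + 1) - F k = g (shift (F k) x) := by rw [hF]; omega
    rw [e]
    exact hgV _ (hmem k)

lemma TT_cons {x : ℕ → Bool} {n : ℕ} (hn : 0 < n) (h1 : inV (pref x n)) (h2 : shift n x ∈ TT) :
    x ∈ TT := by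
  refine TT_coind (TT ∪ {x}) ?_ (Or.inr rfl)
  rintro y (hy | rfl)
  · obtain ⟨m, hm, h, h'⟩ := TT_unfold hy
    exact ⟨m, hm, h, Or.inl h'⟩
  · exact ⟨n, hn, h1, Or.inl h2⟩

def goodP : Set (ℕ → Bool) :=
  {y | (∀ i, y i = false) ∨ y 1 = true}

lemma exists_tail (y : ℕ → Bool) (m : ℕ) : ∃ n ≥ m, shift n y ∈ goodP := by
  by_cases h : ∀ i ≥ m + 1, y i = false
  · exact ⟨m + 1, by omega, Or.inl fun i => h _ (by omega)⟩
  · push Not at h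
    obtain ⟨i, hi, h⟩ := h
    refine ⟨i - 1, by omega, Or.inr ?_⟩
    unfold shift
    rw [show i - 1 + 1 = i by omega]
    simpa using h

lemma goodP_sub : goodP ⊆ TT := by
  refine TT_coind _ ?_
  rintro y (h | h)
  · refine ⟨3, by omega, ?_, Or.inl fun i => h _⟩
    simp [pref, h, List.ofFn_succ, inV]
  · obtain ⟨n, hn, hs⟩ := exists_tail y 2
    refine ⟨n, by omega, ?_, hs⟩
    obtain ⟨k, rfl⟩ : ∃ k, n = k + 1 + 1 := ⟨n - 2, by omega⟩
    rw [pref_succ, pref_succ]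
    simp only [shift, Nat.add_zero, h]
    cases y 0 <;> simp [inV, inN]

/-- If all long prefixes are in the language, the sequence is in the ω-power. -/
lemma TT_of_long {x : ℕ → Bool} (n : ℕ) (h : ∀ m ≥ n, inV (pref x m)) : x ∈ TT := by
  obtain ⟨m, hm, hs⟩ := exists_tail x (n + 1)
  exact TT_cons (by omega) (h m (by omega)) (goodP_sub hs)

lemma inN_dev (k : ℕ) : ∀ (y : ℕ → Bool), (y (3 * k) = true ∨ y (3 * k + 1) = true) →
    ∀ m ≥ 3 * k + 2, inN (pref y m) := by
  induction k with
  | zero =>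
    intro y hy m hm
    obtain ⟨j, rfl⟩ : ∃ j, m = j + 1 + 1 := ⟨m - 2, by omega⟩
    rw [pref_succ, pref_succ]
    simp only [shift, Nat.add_zero]
    simp only [Nat.mul_zero, zero_add] at hy
    rcases hy with hy | hy <;> rw [hy]
    · simp [inN]
    · cases y 0 <;> simp [inN]
  | succ k ih =>
    intro y hy m hm
    obtain ⟨j, rfl⟩ : ∃ j, m = j + 1 + 1 + 1 := ⟨m - 3, by omega⟩
    have := ih (shift 3 y) (by
      unfold shift
      rw [show 3 + 3 * k = 3 * (k + 1) by ring, show 3 + (3 * k + 1) = 3 * (k + 1) + 1 by ring]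
      exact hy) j (by omega)
    rw [pref_succ, pref_succ, pref_succ]
    simp only [shift_shift]
    simp only [shift, Nat.add_zero]
    cases y 0 <;> [cases y 1; skip] <;> simp [inN]
    exact this

lemma inN_nodev (k : ℕ) : ∀ (y : ℕ → Bool),
    (∀ k, y (3 * k) = false ∧ y (3 * k + 1) = false) → (inN (pref y (3 * k))) ∧
     ¬ inN (pref y (3 * k + 1)) ∧ ¬ inN (pref y (3 * k + 2)) := by
  induction k with
  | zero =>
    intro y hy
    have h0 := hy 0
    simp only [Nat.mul_zero, zero_add] at h0
    simp [pref, List.ofFn_succ, inN, h0.1, h0.2]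
  | succ k ih =>
    intro y hy
    have := ih (shift 3 y) (by
      intro k
      unfold shift
      rw [show 3 + 3 * k = 3 * (k + 1) by ring, show 3 + (3 * k + 1) = 3 * (k + 1) + 1 by ring]
      exact hy _)
    have e : ∀ j, inN (pref y (j + 1 + 1 + 1)) ↔ inN (pref (shift 3 y) j) := by
      intro j
      have h0 := hy 0
      simp only [Nat.mul_zero, zero_add] at h0
      rw [pref_succ, pref_succ, pref_succ]
      simp only [shift_shift]
      simp only [shift, Nat.add_zero, h0.1, h0.2, inN]
    rw [show 3 * (k + 1) = 3 * k + 1 + 1 + 1 by ring, e,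
      show 3 * k + 1 + 1 + 1 + 1 = (3 * k + 1) + 1 + 1 + 1 by ring, e,
      show 3 * k + 1 + 1 + 1 + 2 = (3 * k + 2) + 1 + 1 + 1 by ring, e]
    exact this

/-- Words of the language which are prefixes of a sequence beginning with `00`. -/
lemma inV_00 {y : ℕ → Bool} {n : ℕ} (hn : 0 < n) (h0 : y 0 = false) (h1 : y 1 = false)
    (h : inV (pref y n)) : n = 3 ∧ y 2 = false := by
  match n, hn with
  | 1, _ => simp [pref, List.ofFn_succ, h0, inV] at h
  | 2, _ => simp [pref, List.ofFn_succ, h0, h1, inV] at h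
  | 3, _ =>
    refine ⟨rfl, ?_⟩
    cases h2 : y 2
    · rfl
    · simp [pref, List.ofFn_succ, h0, h1, h2, inV] at h
  | k + 4, _ =>
    rw [pref_succ, pref_succ, pref_succ, pref_succ] at h
    simp [shift, h0, h1, inV] at h

lemma landing (k : ℕ) : ∀ t ∈ TT, (∀ k, t (3 * k) = false ∧ t (3 * k + 1) = false) →
    t (3 * k + 2) = false := by
  induction k with
  | zero =>
    intro t ht h
    have h0 := h 0
    obtain ⟨n, hn, hv, -⟩ := TT_unfold ht
    exact (inV_00 hn h0.1 h0.2 hv).2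
  | succ k ih =>
    intro t ht h
    have h0 := h 0
    obtain ⟨n, hn, hv, hs⟩ := TT_unfold ht
    obtain ⟨rfl, -⟩ := inV_00 hn h0.1 h0.2 hv
    have := ih _ hs (by
      intro k
      unfold shift
      rw [show 3 + 3 * k = 3 * (k + 1) by ring, show 3 + (3 * k + 1) = 3 * (k + 1) + 1 by ring]
      exact h _)
    unfold shift at this
    rw [← this]
    congr 1
    ring

def evZ : Set (ℕ → Bool) := {x | ∃ m, ∀ i ≥ m, x i = false}

lemma TT_K {x : ℕ → Bool} (h0 : x 0 = true)
    (hk : ∀ k, x (3 * k + 1) = false ∧ x (3 * k + 2) = false) : x ∈ TT ↔ x ∈ evZ := by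
  have hy : ∀ k, shift 1 x (3 * k) = false ∧ shift 1 x (3 * k + 1) = false := by
    intro k
    unfold shift
    rw [show 1 + 3 * k = 3 * k + 1 by ring, show 1 + (3 * k + 1) = 3 * k + 2 by ring]
    exact hk k
  constructor
  · intro h
    obtain ⟨n, hn, hv, hs⟩ := TT_unfold h
    obtain ⟨j, rfl⟩ : ∃ j, n = j + 1 := ⟨n - 1, by omega⟩
    rw [pref_succ, h0] at hv
    change inN _ at hv
    have hj : ∃ q, j = 3 * q := by
      have := inN_nodev (j / 3) _ hy
      have h3 : j = 3 * (j / 3) ∨ j = 3 * (j / 3) + 1 ∨ j = 3 * (j / 3) + 2 := by omega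
      rcases h3 with h3 | h3 | h3
      · exact ⟨_, h3⟩
      · rw [← h3] at this; exact (this.2.1 hv).elim
      · rw [← h3] at this; exact (this.2.2 hv).elim
    obtain ⟨q, rfl⟩ := hj
    have hl : ∀ k, shift (3 * q + 1) x (3 * k) = false ∧
        shift (3 * q + 1) x (3 * k + 1) = false := by
      intro k
      unfold shift
      rw [show 3 * q + 1 + 3 * k = 3 * (q + k) + 1 by ring,
        show 3 * q + 1 + (3 * k + 1) = 3 * (q + k) + 2 by ring]
      exact hk _
    refine ⟨3 * q + 1, fun i hi => ?_⟩
    obtain ⟨d, rfl⟩ := Nat.exists_eq_add_of_le hi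
    change shift (3 * q + 1) x d = false
    have h3 : d = 3 * (d / 3) ∨ d = 3 * (d / 3) + 1 ∨ d = 3 * (d / 3) + 2 := by omega
    rcases h3 with h3 | h3 | h3 <;> rw [h3]
    · exact (hl _).1
    · exact (hl _).2
    · exact landing _ _ hs hl
  · rintro ⟨m, hm⟩
    refine TT_cons (n := 3 * m + 1) (by omega) ?_
      (goodP_sub (Or.inl fun i => hm _ (by omega)))
    rw [pref_succ, h0]
    exact (inN_nodev m _ hy).1

lemma interior_or (p : ℕ) : ∀ x ∈ TT, x ∉ evZ → x p = true → (∀ i < p, x i = false) →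
    ∃ n, ∀ y, (∀ i < n, x i = y i) → y ∈ TT := by
  induction p using Nat.strong_induction_on with
  | _ p ih =>
  intro x hx hz hp hlt
  cases h0 : x 0
  · cases h1 : x 1
    · obtain ⟨n, hn, hv, hs⟩ := TT_unfold hx
      obtain ⟨rfl, h2⟩ := inV_00 hn h0 h1 hv
      have hp3 : 3 ≤ p := by
        by_contra hc
        have : p = 0 ∨ p = 1 ∨ p = 2 := by omega
        rcases this with rfl | rfl | rfl <;> simp_all
      obtain ⟨n, hn⟩ := ih (p - 3) (by omega) (shift 3 x) hs
        (fun ⟨m, hm⟩ => hz ⟨m + 3, fun i hi => by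
          have := hm (i - 3) (by omega)
          unfold shift at this
          rwa [show 3 + (i - 3) = i by omega] at this⟩)
        (by unfold shift; rwa [show 3 + (p - 3) = p by omega])
        (fun i hi => hlt _ (by omega))
      refine ⟨n + 3, fun y hy => TT_cons (n := 3) (by omega) ?_
        (hn _ fun i hi => hy _ (by omega))⟩
      rwa [← pref_congr (x := x) fun i hi => hy i (by omega)]
    · refine ⟨2, fun y hy => goodP_sub (Or.inr ?_)⟩
      rw [← hy 1 (by omega), h1]
  · by_cases hd : ∃ k, x (3 * k + 1) = true ∨ x (3 * k + 2) = true
    · obtain ⟨k, hk⟩ := hd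
      refine ⟨3 * k + 3, fun y hy => TT_of_long (3 * k + 3) fun m hm => ?_⟩
      rw [hy _ (by omega), hy _ (by omega)] at hk
      obtain ⟨j, rfl⟩ : ∃ j, m = j + 1 := ⟨m - 1, by omega⟩
      rw [pref_succ, ← hy 0 (by omega), h0]
      refine inN_dev k _ ?_ _ (by omega)
      unfold shift
      rw [show 1 + 3 * k = 3 * k + 1 by ring, show 1 + (3 * k + 1) = 3 * k + 2 by ring]
      exact hk
    · push Not at hd
      exact (hz ((TT_K h0 (by simpa using hd)).1 hx)).elim

lemma isOpen_cyl (x : ℕ → Bool) (n : ℕ) : IsOpen {y : ℕ → Bool | ∀ i < n, x i = y i} := by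
  have : {y : ℕ → Bool | ∀ i < n, x i = y i} = ⋂ i ∈ Set.Iio n, (fun y => y i) ⁻¹' {x i} := by
    ext y; simp [eq_comm]
  rw [this]
  exact (Set.finite_Iio n).isOpen_biInter fun i _ =>
    (isOpen_discrete _).preimage (continuous_apply i)

lemma exists_cyl {U : Set (ℕ → Bool)} (hU : IsOpen U) {x : ℕ → Bool} (hx : x ∈ U) :
    ∃ n, ∀ y, (∀ i < n, x i = y i) → y ∈ U := by
  obtain ⟨I, u, h1, h2⟩ := isOpen_pi_iff.1 hU x hx
  refine ⟨I.sup id + 1, fun y hy => h2 fun i hi => ?_⟩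
  rw [← hy i (Nat.lt_succ_of_le (Finset.le_sup (f := id) hi))]
  exact (h1 i hi).2

lemma evZ_countable : evZ.Countable := by
  refine (Set.countable_range fun (l : List Bool) (i : ℕ) => l.getD i false).mono ?_
  rintro x ⟨m, hm⟩
  refine ⟨pref x m, ?_⟩
  funext i
  by_cases h : i < m
  · simp [pref, h]
  · simp [pref, h, hm i (by omega)]

lemma TT_fSigma : FSigmaSet TT := by
  have h : TTᶜ = (interior TT)ᶜ ∩ (TT ∩ evZ)ᶜ := by
    rw [← compl_union, compl_inj_iff]
    refine Subset.antisymm (fun x hx => ?_) (union_subset interior_subset inter_subset_left)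
    by_cases hz : x ∈ evZ
    · exact Or.inr ⟨hx, hz⟩
    · left
      have hex : ∃ p, x p = true := by
        by_contra hc
        push Not at hc
        exact hz ⟨0, fun i _ => by simpa using hc i⟩
      obtain ⟨n, hn⟩ := interior_or (Nat.find hex) x hx hz (Nat.find_spec hex)
        fun i hi => by simpa using Nat.find_min hex hi
      exact mem_interior.2 ⟨_, fun y hy => hn y hy, isOpen_cyl x n, fun _ _ => rfl⟩
  have hG : IsGδ TTᶜ := by
    rw [h]
    refine IsGδ.inter ?_ (evZ_countable.mono inter_subset_right).isGδ_compl
    letI := TopologicalSpace.metrizableSpaceMetric (ℕ → Bool)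
    exact isOpen_interior.isClosed_compl.isGδ
  obtain ⟨U, hU, he⟩ := isGδ_iff_eq_iInter_nat.1 hG
  refine ⟨fun n => (U n)ᶜ, fun n => (hU n).isClosed_compl, ?_⟩
  rw [← compl_iInter, ← he, compl_compl]

def phi (z : ℕ → Bool) : ℕ → Bool := fun i =>
  if i = 0 then true else if i % 3 = 0 then z (i / 3 - 1) else false

lemma phi_cont : Continuous phi := by
  refine continuous_pi fun i => ?_
  unfold phi
  split_ifs <;> fun_prop

lemma phi_pre : phi ⁻¹' TT = evZ := by
  ext z
  rw [mem_preimage, TT_K (by simp [phi]) (fun k => by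
    constructor
    · have : (3 * k + 1) % 3 ≠ 0 := by omega
      simp [phi, this]
    · have : (3 * k + 2) % 3 ≠ 0 := by omega
      simp [phi, this])]
  constructor
  · rintro ⟨m, hm⟩
    refine ⟨m, fun i hi => ?_⟩
    have := hm (3 * (i + 1)) (by omega)
    simpa [phi] using this
  · rintro ⟨m, hm⟩
    refine ⟨3 * m + 3, fun i hi => ?_⟩
    have h1 : i ≠ 0 := by omega
    simp only [phi, h1, if_false]
    split_ifs
    · exact hm _ (by omega)
    · rfl

lemma dense_of_cyl {s : Set (ℕ → Bool)}
    (h : ∀ (x : ℕ → Bool) (n : ℕ), ∃ y ∈ s, ∀ i < n, x i = y i) : Dense s := by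
  rw [dense_iff_inter_open]
  rintro U hU ⟨x, hx⟩
  obtain ⟨n, hn⟩ := exists_cyl hU hx
  obtain ⟨y, hy, hxy⟩ := h x n
  exact ⟨y, hn y hxy, hy⟩

lemma TT_not_gDelta : ¬ GDeltaSet TT := by
  rintro ⟨U, hU, he⟩
  have hG : IsGδ evZ := by
    rw [← phi_pre, he, preimage_iInter]
    exact IsGδ.iInter_of_isOpen fun n => (hU n).preimage phi_cont
  have d1 : Dense evZ := dense_of_cyl fun x n =>
    ⟨fun i => if i < n then x i else false, ⟨n, fun i hi => by simp; omega⟩,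
      fun i hi => by simp [hi]⟩
  have d2 : Dense evZᶜ := dense_of_cyl fun x n =>
    ⟨fun i => if i < n then x i else true, fun ⟨m, hm⟩ => by
      have := hm (max m n) (le_max_left _ _)
      simp at this, fun i hi => by simp [hi]⟩
  have := (Dense.inter_of_Gδ hG evZ_countable.isGδ_compl d1 d2).nonempty
  simp at this

/-- There is a context-free language `A ⊆ 2^{<ω}` whose ω-power is an `F_σ` subset of
Cantor space which is not `G_δ` (i.e. `A^ω ∈ Σ⁰₂ \ Π⁰₂`). -/
theorem exists_contextFree_omegaPower_fSigma_not_gDelta :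
    ∃ A : Language Bool, A.IsContextFree ∧
      FSigmaSet (omegaPower A) ∧ ¬ GDeltaSet (omegaPower A) := by
  refine ⟨vG.language, ⟨vG, rfl⟩, ?_⟩
  rw [vG_language]
  exact ⟨TT_fSigma, TT_not_gDelta⟩
end
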